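/- arXiv:math/0601433 — 2 statements merged into one kernel-verified Lean document; each statement's English description precedes it below -/
import Mathlib

section
/- (C¹ Pasting Lemma for vector fields.) Let n ≥ 2 and α ∈ (0,1). Let K ⊂ ℝⁿ be compact and U a bounded open set with K ⊆ U. Let X : ℝⁿ → ℝⁿ be a C¹ divergence-free vector field whose derivative DX is bounded and uniformly continuous on ℝⁿ. For every ε > 0 there exists δ > 0 such that: for every divergence-free vector field Y : ℝⁿ → ℝⁿ of class C^{1+α} with sup_{x ∈ U} (‖X(x) − Y(x)‖ + ‖DX(x) − DY(x)‖_op) < δ, there exist a divergence-free vector field Z : ℝⁿ → ℝⁿ of class C^{1+α} and an open set V with K ⊆ V ⊆ U such that Z = Y on V and sup_{x ∈ ℝⁿ} (‖Z(x) − X(x)‖ + ‖DZ(x) − DX(x)‖_op) < ε. Moreover, if Y is C^∞ then Z can be chosen C^∞. -/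
noncomputable section

/-- Divergence-free: the trace of the total derivative vanishes everywhere. -/
def DivFree {n : ℕ} (X : EuclideanSpace ℝ (Fin n) → EuclideanSpace ℝ (Fin n)) : Prop :=
  ∀ x, LinearMap.trace ℝ (EuclideanSpace ℝ (Fin n)) (fderiv ℝ X x).toLinearMap = 0

/-- A map is of class C^{1+α}: it is C¹ and its derivative is α-Hölder. -/
def C1Holder {n : ℕ} (α : ℝ) (X : EuclideanSpace ℝ (Fin n) → EuclideanSpace ℝ (Fin n)) : Prop :=
  ContDiff ℝ 1 X ∧ ∃ C : ℝ, 0 ≤ C ∧ ∀ x y, ‖fderiv ℝ X x - fderiv ℝ X y‖ ≤ C * ‖x - y‖ ^ α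

open Set Filter Topology MeasureTheory Metric
open scoped ContDiff

set_option linter.unusedSectionVars false

section Regularity

variable {E F G H : Type*} [NormedAddCommGroup E] [NormedSpace ℝ E]
  [NormedAddCommGroup F] [NormedSpace ℝ F] [NormedAddCommGroup G] [NormedSpace ℝ G]
  [NormedAddCommGroup H] [NormedSpace ℝ H]

/-- `u` is `α`-Hölder on every ball centred at the origin. -/
def LocHolder (α : ℝ) (u : E → F) : Prop :=
  ∀ R : ℝ, ∃ C : ℝ, 0 ≤ C ∧ ∀ x y, ‖x‖ ≤ R → ‖y‖ ≤ R → ‖u x - u y‖ ≤ C * ‖x - y‖ ^ α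

theorem LocHolder.add {α : ℝ} {u v : E → F} (hu : LocHolder α u) (hv : LocHolder α v) :
    LocHolder α (fun x => u x + v x) := by
  intro R
  obtain ⟨C, hC, h⟩ := hu R
  obtain ⟨D, hD, h'⟩ := hv R
  refine ⟨C + D, by positivity, fun x y hx hy => ?_⟩
  calc ‖u x + v x - (u y + v y)‖ = ‖(u x - u y) + (v x - v y)‖ := by congr 1; abel
    _ ≤ ‖u x - u y‖ + ‖v x - v y‖ := norm_add_le _ _
    _ ≤ (C + D) * ‖x - y‖ ^ α := by
      have := h x y hx hy
      have := h' x y hx hy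
      linarith

theorem LocHolder.clm {α : ℝ} {u : E → F} (hu : LocHolder α u) (A : F →L[ℝ] G) :
    LocHolder α (fun x => A (u x)) := by
  intro R
  obtain ⟨C, hC, h⟩ := hu R
  refine ⟨‖A‖ * C, by positivity, fun x y hx hy => ?_⟩
  rw [← map_sub, mul_assoc]
  exact (A.le_opNorm _).trans (mul_le_mul_of_nonneg_left (h x y hx hy) (norm_nonneg _))

theorem Continuous.exists_norm_le_on_closedBall [ProperSpace E] {u : E → F} (hu : Continuous u)
    (R : ℝ) : ∃ C : ℝ, 0 ≤ C ∧ ∀ x, ‖x‖ ≤ R → ‖u x‖ ≤ C := by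
  obtain ⟨C, hC⟩ := (isCompact_closedBall (0 : E) R).exists_bound_of_continuousOn hu.continuousOn
  exact ⟨max C 0, le_max_right _ _, fun x hx => (hC x (by simpa using hx)).trans (le_max_left _ _)⟩

theorem LocHolder.bilin [ProperSpace E] {α : ℝ} {u : E → F} {v : E → G} (hu : LocHolder α u)
    (hv : LocHolder α v) (cu : Continuous u) (cv : Continuous v) (A : F →L[ℝ] G →L[ℝ] H) :
    LocHolder α (fun x => A (u x) (v x)) := by
  intro R
  obtain ⟨C, hC, h⟩ := hu R
  obtain ⟨D, hD, h'⟩ := hv R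
  obtain ⟨M, hM, hu'⟩ := cu.exists_norm_le_on_closedBall R
  obtain ⟨N, hN, hv'⟩ := cv.exists_norm_le_on_closedBall R
  refine ⟨‖A‖ * C * N + ‖A‖ * M * D, by positivity, fun x y hx hy => ?_⟩
  have hα : 0 ≤ ‖x - y‖ ^ α := by positivity
  calc ‖A (u x) (v x) - A (u y) (v y)‖ = ‖A (u x - u y) (v x) + A (u y) (v x - v y)‖ := by
        congr 1; simp
    _ ≤ ‖A (u x - u y) (v x)‖ + ‖A (u y) (v x - v y)‖ := norm_add_le _ _
    _ ≤ ‖A‖ * ‖u x - u y‖ * ‖v x‖ + ‖A‖ * ‖u y‖ * ‖v x - v y‖ :=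
        add_le_add (A.le_opNorm₂ _ _) (A.le_opNorm₂ _ _)
    _ ≤ ‖A‖ * (C * ‖x - y‖ ^ α) * N + ‖A‖ * M * (D * ‖x - y‖ ^ α) := by
        gcongr
        exacts [h x y hx hy, hv' x hx, hu' y hy, h' x y hx hy]
    _ = _ := by ring

theorem norm_le_rpow_mul {α : ℝ} (hα0 : 0 < α) (hα1 : α < 1) {t R : ℝ} (ht : 0 ≤ t) (htR : t ≤ R) :
    t ≤ R ^ (1 - α) * t ^ α := by
  rcases ht.eq_or_lt with rfl | h
  · simp [Real.zero_rpow hα0.ne']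
  · calc t = t ^ (1 - α) * t ^ α := by rw [← Real.rpow_add h]; simp
      _ ≤ R ^ (1 - α) * t ^ α := by
        gcongr

theorem ContDiff.locHolder [ProperSpace E] {α : ℝ} (hα0 : 0 < α) (hα1 : α < 1) {u : E → F}
    (hu : ContDiff ℝ 1 u) : LocHolder α u := by
  intro R
  obtain ⟨M, hM, h⟩ := (hu.continuous_fderiv one_ne_zero).exists_norm_le_on_closedBall R
  refine ⟨M * (2 * max R 0) ^ (1 - α), by positivity, fun x y hx hy => ?_⟩
  have h1 : ‖u x - u y‖ ≤ M * ‖x - y‖ :=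
    (convex_closedBall (0 : E) R).norm_image_sub_le_of_norm_fderiv_le
      (fun z _ => hu.differentiable one_ne_zero z) (fun z hz => h z (by simpa using hz))
      (by simpa using hy) (by simpa using hx)
  have h2 : ‖x - y‖ ≤ 2 * max R 0 := by
    have := norm_sub_le x y
    have := le_max_left R 0
    linarith
  rw [mul_assoc]
  exact h1.trans (mul_le_mul_of_nonneg_left
    (norm_le_rpow_mul hα0 hα1 (norm_nonneg _) h2) hM)

/-- A continuous locally Hölder map vanishing outside a ball is globally Hölder. -/
theorem LocHolder.global {α : ℝ} (hα0 : 0 < α) {u : E → F} (hu : LocHolder α u)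
    {R M : ℝ} (hR : ∀ x, R < ‖x‖ → u x = 0) (hM : ∀ x, ‖u x‖ ≤ M) :
    ∃ C : ℝ, 0 ≤ C ∧ ∀ x y, ‖u x - u y‖ ≤ C * ‖x - y‖ ^ α := by
  obtain ⟨C, hC, h⟩ := hu (R + 1)
  have hM0 : 0 ≤ M := (norm_nonneg _).trans (hM 0)
  refine ⟨C + 2 * M, by positivity, fun x y => ?_⟩
  have hα : 0 ≤ ‖x - y‖ ^ α := by positivity
  by_cases hxy : 1 ≤ ‖x - y‖
  · have h1 : 1 ≤ ‖x - y‖ ^ α := Real.one_le_rpow hxy hα0.le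
    have := norm_sub_le (u x) (u y)
    have := hM x
    have := hM y
    nlinarith [mul_nonneg hC hα]
  · push Not at hxy
    by_cases hx : ‖x‖ ≤ R + 1 ∧ ‖y‖ ≤ R + 1
    · refine (h x y hx.1 hx.2).trans ?_
      nlinarith
    · have h1 : R < ‖x‖ ∧ R < ‖y‖ := by
        have := norm_sub_norm_le x y
        have := norm_sub_norm_le y x
        rw [norm_sub_rev y x] at this
        by_contra hcon
        apply hx
        by_cases h3 : R < ‖x‖
        · have : ‖y‖ ≤ R := by
            by_contra h4
            exact hcon ⟨h3, not_le.1 h4⟩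
          constructor <;> linarith
        · constructor <;> linarith
      rw [hR x h1.1, hR y h1.2]
      simp only [sub_zero, norm_zero]
      positivity

/-- Simultaneous control of a `C¹` map: the map and its derivative are bounded by `B`, the
derivative is locally Hölder as soon as `p` holds and the map is smooth as soon as `q` holds. -/
structure Ctrl (α : ℝ) (p q : Prop) (B : ℝ) (f : E → F) : Prop where
  contDiff : ContDiff ℝ 1 f
  bound : ∀ x, ‖f x‖ ≤ B
  bound_fderiv : ∀ x, ‖fderiv ℝ f x‖ ≤ B
  holder : p → LocHolder α (fderiv ℝ f)
  smooth : q → ContDiff ℝ ∞ f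

variable {α : ℝ} {p q : Prop} {B C : ℝ} {f g : E → F}

theorem Ctrl.nonneg (hf : Ctrl α p q B f) : 0 ≤ B := (norm_nonneg _).trans (hf.bound 0)

theorem Ctrl.mono (hf : Ctrl α p q B f) (h : B ≤ C) : Ctrl α p q C f :=
  ⟨hf.contDiff, fun x => (hf.bound x).trans h, fun x => (hf.bound_fderiv x).trans h, hf.holder,
    hf.smooth⟩

theorem Ctrl.zero (α : ℝ) (p q : Prop) (hB : 0 ≤ B) : Ctrl α p q B (fun _ : E => (0 : F)) :=
  ⟨contDiff_const, by simpa, by simpa, fun _ R => ⟨0, le_rfl, by simp⟩, fun _ => contDiff_const⟩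

theorem Ctrl.add (hf : Ctrl α p q B f) (hg : Ctrl α p q C g) :
    Ctrl α p q (B + C) (fun x => f x + g x) := by
  have hd : fderiv ℝ (fun x => f x + g x) = fun x => fderiv ℝ f x + fderiv ℝ g x := by
    ext1 x
    exact fderiv_fun_add (hf.contDiff.differentiable one_ne_zero x)
      (hg.contDiff.differentiable one_ne_zero x)
  refine ⟨hf.contDiff.add hg.contDiff, fun x => ?_, fun x => ?_, fun h => ?_, fun h => ?_⟩
  · exact norm_add_le_of_le (hf.bound x) (hg.bound x)
  · rw [hd]
    exact norm_add_le_of_le (hf.bound_fderiv x) (hg.bound_fderiv x)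
  · rw [hd]
    exact (hf.holder h).add (hg.holder h)
  · exact (hf.smooth h).add (hg.smooth h)

theorem Ctrl.clm (hf : Ctrl α p q B f) (A : F →L[ℝ] G) :
    Ctrl α p q (‖A‖ * B) (fun x => A (f x)) := by
  have hd : fderiv ℝ (fun x => A (f x)) = fun x => A.comp (fderiv ℝ f x) := by
    ext1 x
    exact (A.hasFDerivAt.comp x (hf.contDiff.differentiable one_ne_zero x).hasFDerivAt).fderiv
  refine ⟨A.contDiff.comp hf.contDiff, fun x => ?_, fun x => ?_, fun h => ?_, fun h => ?_⟩
  · exact (A.le_opNorm _).trans (mul_le_mul_of_nonneg_left (hf.bound x) (norm_nonneg _))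
  · rw [hd]
    exact (A.opNorm_comp_le _).trans
      (mul_le_mul_of_nonneg_left (hf.bound_fderiv x) (norm_nonneg _))
  · rw [hd]
    exact (hf.holder h).clm (ContinuousLinearMap.compL ℝ E F G A)
  · exact A.contDiff.comp (hf.smooth h)

theorem Ctrl.const_smul (hf : Ctrl α p q B f) (c : ℝ) :
    Ctrl α p q (|c| * B) (fun x => c • f x) := by
  have h := hf.clm (c • ContinuousLinearMap.id ℝ F)
  refine Ctrl.mono (by simpa using h) ?_
  have : ‖c • ContinuousLinearMap.id ℝ F‖ ≤ |c| := by
    rw [norm_smul, Real.norm_eq_abs]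
    exact mul_le_of_le_one_right (abs_nonneg _) ContinuousLinearMap.norm_id_le
  exact mul_le_mul_of_nonneg_right this hf.nonneg

theorem Ctrl.sub (hf : Ctrl α p q B f) (hg : Ctrl α p q C g) :
    Ctrl α p q (B + C) (fun x => f x - g x) := by
  have h := hf.add (hg.const_smul (-1))
  simpa [sub_eq_add_neg] using h

theorem Ctrl.sum {ι : Type*} (s : Finset ι) {f : ι → E → F} {B : ι → ℝ}
    (hf : ∀ i ∈ s, Ctrl α p q (B i) (f i)) :
    Ctrl α p q (∑ i ∈ s, B i) (fun x => ∑ i ∈ s, f i x) := by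
  classical
  induction s using Finset.induction_on with
  | empty => simpa using Ctrl.zero α p q le_rfl
  | insert a s ha ih =>
    simp only [Finset.sum_insert ha]
    exact (hf a (Finset.mem_insert_self _ _)).add
      (ih fun i hi => hf i (Finset.mem_insert_of_mem hi))

theorem HasCompactSupport.exists_norm_le {u : E → F} (hu : HasCompactSupport u)
    (cu : Continuous u) : ∃ C : ℝ, 0 ≤ C ∧ ∀ x, ‖u x‖ ≤ C := by
  obtain ⟨C, hC⟩ := hu.exists_bound_of_continuous cu
  exact ⟨max C 0, le_max_right _ _, fun x => (hC x).trans (le_max_left _ _)⟩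

/-- Multiplication by a fixed smooth compactly supported function is bounded, with bounds
on the second factor needed only on the support of the first. -/
theorem exists_ctrl_smul [ProperSpace E] (hα0 : 0 < α) (hα1 : α < 1) {χ : E → ℝ}
    (hχ : ContDiff ℝ ∞ χ) (hχc : HasCompactSupport χ) :
    ∃ C : ℝ, 0 ≤ C ∧ ∀ {F : Type} [NormedAddCommGroup F] [NormedSpace ℝ F] (p q : Prop) (B : ℝ)
      (f : E → F), 0 ≤ B → ContDiff ℝ 1 f →
      (∀ x ∈ tsupport χ, ‖f x‖ ≤ B ∧ ‖fderiv ℝ f x‖ ≤ B) →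
      (p → LocHolder α (fderiv ℝ f)) → (q → ContDiff ℝ ∞ f) →
      Ctrl α p q (C * B) (fun x => χ x • f x) := by
  have hχ1 : ContDiff ℝ 1 χ := hχ.of_le (by simp)
  have hdχ : ContDiff ℝ 1 (fderiv ℝ χ) := (contDiff_infty.1 hχ 2).fderiv_right (by norm_num)
  obtain ⟨C, hC, h⟩ := hχc.exists_norm_le hχ.continuous
  obtain ⟨D, hD, h'⟩ := (hχc.fderiv ℝ).exists_norm_le hdχ.continuous
  refine ⟨C + D, by positivity, fun {F} _ _ p q B f hB hf hb hp hq => ?_⟩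
  have hd : fderiv ℝ (fun x => χ x • f x) =
      fun x => χ x • fderiv ℝ f x + (fderiv ℝ χ x).smulRight (f x) := by
    ext1 x
    exact fderiv_fun_smul (hχ1.differentiable one_ne_zero x) (hf.differentiable one_ne_zero x)
  refine ⟨hχ1.smul hf, fun x => ?_, fun x => ?_, fun hp' => ?_, fun hq' => hχ.smul (hq hq')⟩
  · by_cases hx : x ∈ tsupport χ
    · rw [norm_smul]
      have h1 := h x
      have h2 := (hb x hx).1
      calc ‖χ x‖ * ‖f x‖ ≤ C * B := by gcongr
        _ ≤ (C + D) * B := by gcongr; linarith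
    · rw [image_eq_zero_of_notMem_tsupport hx]
      simp only [zero_smul, norm_zero]
      positivity
  · rw [hd]
    by_cases hx : x ∈ tsupport χ
    · have h1 := h x
      have h2 := (hb x hx).1
      have h3 := h' x
      have h4 := (hb x hx).2
      calc ‖χ x • fderiv ℝ f x + (fderiv ℝ χ x).smulRight (f x)‖
          ≤ ‖χ x • fderiv ℝ f x‖ + ‖(fderiv ℝ χ x).smulRight (f x)‖ := norm_add_le _ _
        _ = ‖χ x‖ * ‖fderiv ℝ f x‖ + ‖fderiv ℝ χ x‖ * ‖f x‖ := by
          rw [norm_smul, ContinuousLinearMap.norm_smulRight_apply]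
        _ ≤ C * B + D * B := by gcongr
        _ = (C + D) * B := by ring
    · have h0 : fderiv ℝ χ x = 0 :=
        image_eq_zero_of_notMem_tsupport fun h => hx (tsupport_fderiv_subset ℝ h)
      have h1 : χ x = 0 := image_eq_zero_of_notMem_tsupport hx
      simp only [h0, h1, zero_smul, ContinuousLinearMap.zero_smulRight, add_zero, norm_zero]
      positivity
  · rw [hd]
    refine LocHolder.add ?_ ?_
    · exact (hχ1.locHolder hα0 hα1).bilin (hp hp') hχ.continuous (hf.continuous_fderiv one_ne_zero)
        (ContinuousLinearMap.lsmul ℝ ℝ)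
    · exact (hdχ.locHolder hα0 hα1).bilin (hf.locHolder hα0 hα1) hdχ.continuous hf.continuous
        (ContinuousLinearMap.smulRightL ℝ E F)

end Regularity

section LineIntegral

variable {E F : Type} [NormedAddCommGroup E] [NormedSpace ℝ E]
  [NormedAddCommGroup F] [NormedSpace ℝ F]

/-- The integral of `f` over the points `x - t • e`, `t ∈ s`. -/
def lineInt (s : Set ℝ) (e : E) (f : E → F) (x : E) : F := ∫ t in s, f (x - t • e)

variable {s : Set ℝ} {e : E} {f : E → F} {R : ℝ}

theorem hasCompactSupport_comp_line (he : ‖e‖ = 1) (hR : ∀ x, R < ‖x‖ → f x = 0) (x : E) :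
    HasCompactSupport (fun t : ℝ => f (x - t • e)) := by
  refine HasCompactSupport.intro (isCompact_closedBall (0 : ℝ) (R + ‖x‖)) fun t ht => hR _ ?_
  have h1 : R + ‖x‖ < |t| := by simpa using ht
  have h2 := norm_sub_norm_le (t • e) x
  rw [norm_sub_rev, norm_smul, he, Real.norm_eq_abs] at h2
  linarith

theorem integrable_comp_line (he : ‖e‖ = 1) (hf : Continuous f) (hR : ∀ x, R < ‖x‖ → f x = 0)
    (x : E) : Integrable (fun t : ℝ => f (x - t • e)) :=
  (by fun_prop : Continuous fun t : ℝ => f (x - t • e)).integrable_of_hasCompactSupport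
    (hasCompactSupport_comp_line he hR x)

theorem volume_line_preimage_le (he : ‖e‖ = 1) (x : E) :
    volume {t : ℝ | ‖x - t • e‖ ≤ R} ≤ ENNReal.ofReal (2 * R) := by
  refine (Real.volume_le_diam _).trans (ediam_le fun a ha b hb => ?_)
  rw [edist_dist]
  refine ENNReal.ofReal_le_ofReal ?_
  have h : ‖(x - b • e) - (x - a • e)‖ = dist a b := by
    rw [show (x - b • e) - (x - a • e) = (a - b) • e by rw [sub_smul]; abel, norm_smul, he, mul_one,
      Real.dist_eq, Real.norm_eq_abs]
  rw [← h]
  have ha' : ‖x - a • e‖ ≤ R := ha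
  have hb' : ‖x - b • e‖ ≤ R := hb
  exact (norm_sub_le _ _).trans (by linarith)

theorem norm_setIntegral_le_of_support {s T : Set ℝ} {h : ℝ → F} {c B : ℝ} (hs : MeasurableSet s)
    (hc : 0 ≤ c) (hT : volume T ≤ ENNReal.ofReal c) (h0 : ∀ t ∉ T, h t = 0) (hB : 0 ≤ B)
    (hb : ∀ t, ‖h t‖ ≤ B) : ‖∫ t in s, h t‖ ≤ B * c := by
  have hfin : volume (s ∩ T) < ⊤ :=
    (measure_mono inter_subset_right).trans_lt (hT.trans_lt ENNReal.ofReal_lt_top)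
  have h1 : ∫ t in s, h t = ∫ t in s ∩ T, h t :=
    setIntegral_eq_of_subset_of_forall_sdiff_eq_zero hs inter_subset_left
      fun t ht => h0 t fun hT' => ht.2 ⟨ht.1, hT'⟩
  rw [h1]
  refine (norm_setIntegral_le_of_norm_le_const hfin fun t _ => hb t).trans ?_
  refine mul_le_mul_of_nonneg_left ?_ hB
  exact ENNReal.toReal_le_of_le_ofReal hc ((measure_mono inter_subset_right).trans hT)

theorem norm_lineInt_le (hs : MeasurableSet s) (he : ‖e‖ = 1) (hR0 : 0 ≤ R)
    (hR : ∀ x, R < ‖x‖ → f x = 0) {B : ℝ} (hB : ∀ x, ‖f x‖ ≤ B) (x : E) :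
    ‖lineInt s e f x‖ ≤ 2 * R * B := by
  rw [mul_comm]
  exact norm_setIntegral_le_of_support hs (by positivity) (volume_line_preimage_le he x)
    (fun t ht => hR _ (not_le.1 ht)) ((norm_nonneg _).trans (hB 0)) fun t => hB _

theorem hasFDerivAt_lineInt (he : ‖e‖ = 1) (hf : ContDiff ℝ 1 f)
    (hR : ∀ x, R < ‖x‖ → f x = 0) (hR' : ∀ x, R < ‖x‖ → fderiv ℝ f x = 0)
    {B : ℝ} (hB : ∀ x, ‖fderiv ℝ f x‖ ≤ B) (x₀ : E) :
    HasFDerivAt (lineInt s e f) (lineInt s e (fderiv ℝ f) x₀) x₀ := by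
  have hcf' := hf.continuous_fderiv one_ne_zero
  refine hasFDerivAt_integral_of_dominated_of_fderiv_le
    (F := fun x t => f (x - t • e)) (F' := fun x t => fderiv ℝ f (x - t • e))
    (bound := (Icc (-(R + ‖x₀‖ + 1)) (R + ‖x₀‖ + 1)).indicator fun _ => B)
    (ball_mem_nhds x₀ one_pos) ?_ ?_ ?_ ?_ ?_ ?_
  · exact Eventually.of_forall fun x =>
      (integrable_comp_line he hf.continuous hR x).aestronglyMeasurable.restrict
  · exact (integrable_comp_line he hf.continuous hR x₀).integrableOn
  · exact (integrable_comp_line he hcf' hR' x₀).aestronglyMeasurable.restrict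
  · refine Eventually.of_forall fun t x hx => ?_
    by_cases ht : t ∈ Icc (-(R + ‖x₀‖ + 1)) (R + ‖x₀‖ + 1)
    · rw [indicator_of_mem ht]
      exact hB _
    · rw [indicator_of_notMem ht, hR', norm_zero]
      have h1 : R + ‖x₀‖ + 1 < |t| := by
        rw [mem_Icc, ← abs_le] at ht
        exact not_le.1 ht
      have h2 := norm_sub_norm_le (t • e) x
      rw [norm_sub_rev, norm_smul, he, Real.norm_eq_abs] at h2
      have h3 : ‖x - x₀‖ < 1 := by simpa [dist_eq_norm] using hx
      have h4 := norm_sub_norm_le x x₀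
      linarith
  · exact ((integrable_indicator_iff measurableSet_Icc).2
      (integrableOn_const (by simp))).integrableOn
  · refine Eventually.of_forall fun t x _ => ?_
    exact ((hf.differentiable one_ne_zero (x - t • e)).hasFDerivAt.comp x
      ((hasFDerivAt_id x).sub_const (t • e))).congr_fderiv (by ext; simp)

theorem fderiv_eq_zero_of_norm_lt (hR : ∀ x, R < ‖x‖ → f x = 0) (x : E) (hx : R < ‖x‖) :
    fderiv ℝ f x = 0 := by
  have h : f =ᶠ[𝓝 x] fun _ => 0 := by
    filter_upwards [(isOpen_lt continuous_const continuous_norm).mem_nhds hx] with y hy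
    exact hR y hy
  rw [h.fderiv_eq]
  simp

theorem hasCompactSupport_of_norm_lt [ProperSpace E] (hR : ∀ x, R < ‖x‖ → f x = 0) :
    HasCompactSupport f :=
  HasCompactSupport.intro (isCompact_closedBall 0 R) fun x hx => hR x (by simpa using hx)

theorem fderiv_lineInt [ProperSpace E] (he : ‖e‖ = 1) (hf : ContDiff ℝ 1 f)
    (hR : ∀ x, R < ‖x‖ → f x = 0) : fderiv ℝ (lineInt s e f) = lineInt s e (fderiv ℝ f) := by
  obtain ⟨B, -, hB⟩ := ((hasCompactSupport_of_norm_lt hR).fderiv ℝ).exists_norm_le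
    (hf.continuous_fderiv one_ne_zero)
  ext1 x
  exact (hasFDerivAt_lineInt he hf hR (fderiv_eq_zero_of_norm_lt hR) hB x).fderiv

theorem differentiable_lineInt [ProperSpace E] (he : ‖e‖ = 1) (hf : ContDiff ℝ 1 f)
    (hR : ∀ x, R < ‖x‖ → f x = 0) : Differentiable ℝ (lineInt s e f) := by
  obtain ⟨B, -, hB⟩ := ((hasCompactSupport_of_norm_lt hR).fderiv ℝ).exists_norm_le
    (hf.continuous_fderiv one_ne_zero)
  exact fun x =>
    (hasFDerivAt_lineInt he hf hR (fderiv_eq_zero_of_norm_lt hR) hB x).differentiableAt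

theorem continuous_lineInt [ProperSpace E] (he : ‖e‖ = 1) (hf : Continuous f)
    (hR : ∀ x, R < ‖x‖ → f x = 0) : Continuous (lineInt s e f) := by
  obtain ⟨B, hB0, hB⟩ := (hasCompactSupport_of_norm_lt hR).exists_norm_le hf
  refine continuous_iff_continuousAt.2 fun x₀ => ?_
  refine continuousAt_of_dominated (F := fun x t => f (x - t • e))
    (bound := (Icc (-(R + ‖x₀‖ + 1)) (R + ‖x₀‖ + 1)).indicator fun _ => B) ?_ ?_ ?_ ?_
  · exact Eventually.of_forall fun x =>
      (integrable_comp_line he hf hR x).aestronglyMeasurable.restrict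
  · filter_upwards [ball_mem_nhds x₀ one_pos] with x hx
    refine Eventually.of_forall fun t => ?_
    by_cases ht : t ∈ Icc (-(R + ‖x₀‖ + 1)) (R + ‖x₀‖ + 1)
    · rw [indicator_of_mem ht]
      exact hB _
    · rw [indicator_of_notMem ht, hR, norm_zero]
      have h1 : R + ‖x₀‖ + 1 < |t| := by
        rw [mem_Icc, ← abs_le] at ht
        exact not_le.1 ht
      have h2 := norm_sub_norm_le (t • e) x
      rw [norm_sub_rev, norm_smul, he, Real.norm_eq_abs] at h2
      have h3 : ‖x - x₀‖ < 1 := by simpa [dist_eq_norm] using hx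
      have h4 := norm_sub_norm_le x x₀
      linarith
  · exact ((integrable_indicator_iff measurableSet_Icc).2
      (integrableOn_const (by simp))).integrableOn
  · exact Eventually.of_forall fun t =>
      (by fun_prop : Continuous fun x => f (x - t • e)).continuousAt

theorem contDiff_lineInt [ProperSpace E] (he : ‖e‖ = 1) (k : ℕ) :
    ∀ {F : Type} [NormedAddCommGroup F] [NormedSpace ℝ F] {f : E → F}, ContDiff ℝ k f →
      (∀ x, R < ‖x‖ → f x = 0) → ContDiff ℝ k (lineInt s e f) := by
  induction k with
  | zero =>
    intro F _ _ f hf hR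
    exact contDiff_zero.2 (continuous_lineInt he hf.continuous hR)
  | succ k ih =>
    intro F _ _ f hf hR
    have hf1 : ContDiff ℝ 1 f := hf.of_le (by exact mod_cast Nat.le_add_left 1 k)
    push_cast at hf ⊢
    rw [contDiff_succ_iff_fderiv]
    refine ⟨differentiable_lineInt he hf1 hR, by simp, ?_⟩
    rw [fderiv_lineInt he hf1 hR]
    exact ih (hf.fderiv_right le_rfl) (fderiv_eq_zero_of_norm_lt hR)

theorem LocHolder.lineInt {α : ℝ} (hs : MeasurableSet s) (he : ‖e‖ = 1) (hR0 : 0 ≤ R)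
    (hα : 0 < α) (hf : Continuous f) (hR : ∀ x, R < ‖x‖ → f x = 0) {B : ℝ} (hB : ∀ x, ‖f x‖ ≤ B)
    (hh : LocHolder α f) : LocHolder α (lineInt s e f) := by
  obtain ⟨C, hC, h⟩ := hh.global hα hR hB
  intro r
  refine ⟨C * (4 * R), by positivity, fun x y _ _ => ?_⟩
  unfold _root_.lineInt
  rw [← integral_sub (integrable_comp_line he hf hR x).integrableOn
    (integrable_comp_line he hf hR y).integrableOn, mul_right_comm]
  refine norm_setIntegral_le_of_support
    (T := {t : ℝ | ‖x - t • e‖ ≤ R} ∪ {t : ℝ | ‖y - t • e‖ ≤ R}) hs (by positivity) ?_ ?_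
    (by positivity) fun t => ?_
  · refine (measure_union_le _ _).trans ((add_le_add (volume_line_preimage_le he x)
      (volume_line_preimage_le he y)).trans ?_)
    rw [← ENNReal.ofReal_add (by positivity) (by positivity)]
    exact ENNReal.ofReal_le_ofReal (by linarith)
  · intro t ht
    simp only [mem_union, mem_ofPred_eq, not_or, not_le] at ht
    rw [hR _ ht.1, hR _ ht.2, sub_zero]
  · simpa using h (x - t • e) (y - t • e)

theorem Ctrl.lineInt [ProperSpace E] {α B : ℝ} {p q : Prop} (hs : MeasurableSet s)
    (he : ‖e‖ = 1) (hR0 : 0 ≤ R) (hα : 0 < α) (hR : ∀ x, R < ‖x‖ → f x = 0)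
    (hf : Ctrl α p q B f) : Ctrl α p q (2 * R * B) (lineInt s e f) := by
  refine ⟨?_, norm_lineInt_le hs he hR0 hR hf.bound, fun x => ?_, fun hp => ?_, fun hq => ?_⟩
  · exact contDiff_lineInt he 1 (by simpa using hf.contDiff) hR
  · rw [fderiv_lineInt he hf.contDiff hR]
    exact norm_lineInt_le hs he hR0 (fderiv_eq_zero_of_norm_lt hR) hf.bound_fderiv x
  · rw [fderiv_lineInt he hf.contDiff hR]
    exact (hf.holder hp).lineInt hs he hR0 hα (hf.contDiff.continuous_fderiv one_ne_zero)
      (fderiv_eq_zero_of_norm_lt hR) hf.bound_fderiv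
  · exact contDiff_infty.2 fun k => contDiff_lineInt he k (contDiff_infty.1 (hf.smooth hq) k) hR

variable {g : E → ℝ}

theorem hasDerivAt_comp_line (hg : ContDiff ℝ 1 g) (x : E) (t : ℝ) :
    HasDerivAt (fun t : ℝ => g (x - t • e)) (-(fderiv ℝ g (x - t • e) e)) t := by
  have h1 : HasDerivAt (fun t : ℝ => x - t • e) (-e) t := by
    simpa using ((hasDerivAt_id t).smul_const e).const_sub x
  exact ((hg.differentiable one_ne_zero (x - t • e)).hasFDerivAt.comp_hasDerivAt t h1).congr_deriv
    (map_neg _ _)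

theorem integral_Ioi_fderiv_line (he : ‖e‖ = 1) (hg : ContDiff ℝ 1 g)
    (hR : ∀ x, R < ‖x‖ → g x = 0) (x : E) :
    ∫ t in Ioi (0 : ℝ), fderiv ℝ g (x - t • e) e = g x := by
  have h1 := HasCompactSupport.integral_Ioi_deriv_eq (f := fun t : ℝ => g (x - t • e))
    (by fun_prop) (hasCompactSupport_comp_line he hR x) 0
  simp only [(hasDerivAt_comp_line hg x _).deriv, integral_neg, zero_smul, sub_zero, neg_inj] at h1
  exact h1

theorem integral_fderiv_line (he : ‖e‖ = 1) (hg : ContDiff ℝ 1 g)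
    (hR : ∀ x, R < ‖x‖ → g x = 0) (x : E) :
    ∫ t : ℝ, fderiv ℝ g (x - t • e) e = 0 := by
  have h1 := integral_eq_zero_of_hasDerivAt_of_integrable (f := fun t : ℝ => g (x - t • e))
    (hasDerivAt_comp_line hg x) ?_ (integrable_comp_line he hg.continuous hR x)
  · simpa [integral_neg] using h1
  · exact (((integrable_comp_line he (hg.continuous_fderiv one_ne_zero)
      (fderiv_eq_zero_of_norm_lt hR) x)).apply_continuousLinearMap e).neg

theorem fderiv_lineInt_apply [ProperSpace E] (he : ‖e‖ = 1) (hg : ContDiff ℝ 1 g)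
    (hR : ∀ x, R < ‖x‖ → g x = 0) (x w : E) :
    fderiv ℝ (lineInt s e g) x w = ∫ t in s, fderiv ℝ g (x - t • e) w := by
  rw [fderiv_lineInt he hg hR]
  exact ContinuousLinearMap.integral_apply
    (integrable_comp_line he (hg.continuous_fderiv one_ne_zero)
      (fderiv_eq_zero_of_norm_lt hR) x).integrableOn w

end LineIntegral

section Box

variable {n : ℕ}

/-- The `k`-th coordinate vector. -/
abbrev coordVec (k : Fin n) : EuclideanSpace ℝ (Fin n) := EuclideanSpace.single k 1

theorem norm_coordVec (k : Fin n) : ‖coordVec k‖ = 1 := by simp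

theorem sub_smul_coordVec_apply_self (x : EuclideanSpace ℝ (Fin n)) (t : ℝ) (k : Fin n) :
    (x - t • coordVec k) k = x k - t := by simp

theorem sub_smul_coordVec_apply_of_ne (x : EuclideanSpace ℝ (Fin n)) (t : ℝ) {j k : Fin n}
    (h : j ≠ k) : (x - t • coordVec k) j = x j := by simp [h]

/-- The closed box with centre `c` and half-width `r`. -/
def box (c : EuclideanSpace ℝ (Fin n)) (r : ℝ) : Set (EuclideanSpace ℝ (Fin n)) :=
  {x | ∀ j, |x j - c j| ≤ r}

theorem EuclideanSpace.norm_le_sum_abs (x : EuclideanSpace ℝ (Fin n)) : ‖x‖ ≤ ∑ j, |x j| := by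
  have h : x = ∑ j, x j • coordVec j := by
    simpa using ((EuclideanSpace.basisFun (Fin n) ℝ).sum_repr x).symm
  calc ‖x‖ = ‖∑ j, x j • coordVec j‖ := by rw [← h]
    _ ≤ ∑ j, ‖x j • coordVec j‖ := norm_sum_le _ _
    _ = ∑ j, |x j| := by simp [norm_smul]

theorem norm_sub_le_of_mem_box {c x : EuclideanSpace ℝ (Fin n)} {r : ℝ} (hx : x ∈ box c r) :
    ‖x - c‖ ≤ n * r := by
  refine (EuclideanSpace.norm_le_sum_abs _).trans ?_
  calc ∑ j, |(x - c) j| ≤ ∑ _j : Fin n, r := Finset.sum_le_sum fun j _ => by simpa using hx j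
    _ = n * r := by simp

theorem eq_zero_of_norm_gt_of_box {c : EuclideanSpace ℝ (Fin n)} {r : ℝ}
    {g : EuclideanSpace ℝ (Fin n) → ℝ} (hg : ∀ x ∉ box c r, g x = 0) :
    ∀ x, ‖c‖ + n * |r| < ‖x‖ → g x = 0 := by
  intro x hx
  refine hg x fun hxb => ?_
  have h1 := norm_sub_le_of_mem_box hxb
  have h2 := norm_sub_norm_le x c
  have h3 : (n : ℝ) * r ≤ n * |r| := by
    gcongr
    exact le_abs_self r
  linarith

theorem isClosed_box (c : EuclideanSpace ℝ (Fin n)) (r : ℝ) : IsClosed (box c r) := by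
  simp only [box, ofPred_forall]
  exact isClosed_iInter fun j => isClosed_le (by fun_prop) continuous_const

theorem lineInt_univ_sub_smul {E : Type} [NormedAddCommGroup E] [NormedSpace ℝ E] (e : E)
    (g : E → ℝ) (x : E) (a : ℝ) : lineInt univ e g (x - a • e) = lineInt univ e g x := by
  unfold lineInt
  simp only [Measure.restrict_univ]
  rw [← integral_add_right_eq_self (fun t => g (x - t • e)) a]
  congr 1
  ext t
  congr 1
  rw [add_smul]
  abel

theorem exists_box_step {α : ℝ} (hα0 : 0 < α) (hα1 : α < 1) (c : EuclideanSpace ℝ (Fin n)) (r : ℝ)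
    (k : Fin n) {χ : ℝ → ℝ} (hχ : ContDiff ℝ ∞ χ) (hχ0 : ∀ t, r < |t - c k| → χ t = 0)
    (hχ1 : ∫ t, χ t = 1) :
    ∃ C : ℝ, 0 ≤ C ∧ ∀ (p q : Prop) (B : ℝ) (g : EuclideanSpace ℝ (Fin n) → ℝ),
      Ctrl α p q B g → (∀ x ∉ box c r, g x = 0) →
      ∃ u : EuclideanSpace ℝ (Fin n) → ℝ,
        Ctrl α p q (C * B) u ∧ (∀ x ∉ box c r, u x = 0) ∧
        Ctrl α p q (C * B) (fun x => χ (x k) * lineInt univ (coordVec k) g x) ∧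
        (∀ x ∉ box c r, χ (x k) * lineInt univ (coordVec k) g x = 0) ∧
        ∀ x, fderiv ℝ u x (coordVec k) =
          g x - χ (x k) * lineInt univ (coordVec k) g x := by
  set R : ℝ := ‖c‖ + n * |r| with hRdef
  have hR0 : 0 ≤ R := by positivity
  let κ : ContDiffBump (0 : EuclideanSpace ℝ (Fin n)) :=
    ⟨R + 1, R + 2, by linarith, by linarith⟩
  have hχκ : ContDiff ℝ ∞ (fun x : EuclideanSpace ℝ (Fin n) => κ x * χ (x k)) :=
    κ.contDiff.mul (hχ.comp (by fun_prop))
  obtain ⟨C, hC, hmul⟩ := exists_ctrl_smul hα0 hα1 hχκ (κ.hasCompactSupport.mul_right)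
  refine ⟨2 * R * (1 + C * (2 * R)) + C * (2 * R), by positivity, fun p q B g hg hg0 => ?_⟩
  have hgR := eq_zero_of_norm_gt_of_box hg0
  have hB := hg.nonneg
  set S := lineInt univ (coordVec k) g with hS
  have hoff : ∀ x, (∃ j, j ≠ k ∧ r < |x j - c j|) → S x = 0 := by
    rintro x ⟨j, hjk, hj⟩
    refine integral_eq_zero_of_ae (Eventually.of_forall fun t => hg0 _ fun hx => ?_)
    have := hx j
    rw [sub_smul_coordVec_apply_of_ne x t hjk] at this
    linarith
  have hg'0 : ∀ x ∉ box c r, χ (x k) * S x = 0 := by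
    intro x hx
    simp only [box, mem_ofPred_eq, not_forall, not_le] at hx
    obtain ⟨j, hj⟩ := hx
    by_cases hjk : j = k
    · subst hjk
      rw [hχ0 _ hj, zero_mul]
    · rw [hoff x ⟨j, hjk, hj⟩, mul_zero]
  have hSc : Ctrl α p q (2 * R * B) S :=
    hg.lineInt MeasurableSet.univ (norm_coordVec k) hR0 hα0 hgR
  have hg'c : Ctrl α p q (C * (2 * R * B)) (fun x => χ (x k) * S x) := by
    have h := hmul p q _ S (by positivity) hSc.contDiff
      (fun x _ => ⟨hSc.bound x, hSc.bound_fderiv x⟩) hSc.holder hSc.smooth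
    convert h using 1
    ext x
    by_cases hx : x ∈ box c r
    · have h1 : κ x = 1 := by
        refine κ.one_of_mem_closedBall ?_
        have h2 := norm_sub_le_of_mem_box hx
        have h3 := norm_sub_norm_le x c
        have h4 : (n : ℝ) * r ≤ n * |r| := by
          gcongr
          exact le_abs_self r
        rw [mem_closedBall_zero_iff]
        change ‖x‖ ≤ R + 1
        linarith
      simp [h1]
    · rw [smul_eq_mul, mul_assoc, hg'0 x hx, mul_zero]
  have hd := hg.sub hg'c
  have hd0 : ∀ x ∉ box c r, g x - χ (x k) * S x = 0 := fun x hx => by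
    rw [hg0 x hx, hg'0 x hx, sub_zero]
  have hdR := eq_zero_of_norm_gt_of_box hd0
  have hu := hd.lineInt measurableSet_Ioi (norm_coordVec k) hR0 hα0 hdR (s := Ioi 0)
  have hle : C * (2 * R * B) ≤ (2 * R * (1 + C * (2 * R)) + C * (2 * R)) * B := by
    have : 0 ≤ 2 * R * (1 + C * (2 * R)) * B := by positivity
    nlinarith
  have hle' : 2 * R * (B + C * (2 * R * B)) ≤
      (2 * R * (1 + C * (2 * R)) + C * (2 * R)) * B := by
    have : 0 ≤ C * (2 * R) * B := by positivity
    nlinarith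
  refine ⟨lineInt (Ioi 0) (coordVec k) fun x => g x - χ (x k) * S x, hu.mono hle', ?_,
    hg'c.mono hle, hg'0, fun x => ?_⟩
  · intro x hx
    by_cases hj : ∃ j, j ≠ k ∧ r < |x j - c j|
    · obtain ⟨j, hjk, hj⟩ := hj
      refine integral_eq_zero_of_ae (Eventually.of_forall fun t => hd0 _ fun hx => ?_)
      have := hx j
      rw [sub_smul_coordVec_apply_of_ne x t hjk] at this
      linarith
    have hk : r < |x k - c k| := by
      by_contra hk
      refine hx fun j => ?_
      by_cases hjk : j = k
      · subst hjk; exact not_lt.1 hk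
      · by_contra h
        exact hj ⟨j, hjk, not_le.1 h⟩
    have hzero : ∀ t : ℝ, r < |x k - t - c k| →
        g (x - t • coordVec k) - χ ((x - t • coordVec k) k) * S (x - t • coordVec k) = 0 := by
      intro t ht
      refine hd0 _ fun hx => ?_
      have := hx k
      rw [sub_smul_coordVec_apply_self] at this
      linarith
    rcases lt_abs.1 hk with hk | hk
    · have hfull : lineInt (Ioi 0) (coordVec k) (fun x => g x - χ (x k) * S x) x =
          ∫ t : ℝ, (g (x - t • coordVec k)
            - χ ((x - t • coordVec k) k) * S (x - t • coordVec k)) := by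
        refine setIntegral_eq_integral_of_forall_compl_eq_zero fun t ht => hzero t ?_
        have : t ≤ 0 := not_lt.1 ht
        exact lt_of_lt_of_le (by linarith) (le_abs_self _)
      rw [hfull, integral_sub (integrable_comp_line (norm_coordVec k) hg.contDiff.continuous hgR x)
        (integrable_comp_line (f := fun x => χ (x k) * S x) (norm_coordVec k)
          hg'c.contDiff.continuous (eq_zero_of_norm_gt_of_box hg'0) x)]
      have h1 : ∫ t : ℝ, χ ((x - t • coordVec k) k) * S (x - t • coordVec k) = S x := by
        simp only [hS, lineInt_univ_sub_smul, sub_smul_coordVec_apply_self]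
        rw [integral_mul_const, integral_sub_left_eq_self χ volume (x k), hχ1, one_mul]
      rw [h1, hS, lineInt, Measure.restrict_univ, sub_self]
    · refine setIntegral_eq_zero_of_forall_eq_zero fun t ht => hzero t ?_
      have : 0 < t := ht
      exact lt_of_lt_of_le (by linarith) (neg_le_abs _)
  · rw [fderiv_lineInt_apply (norm_coordVec k) hd.contDiff hdR,
      integral_Ioi_fderiv_line (norm_coordVec k) hd.contDiff hdR]

theorem exists_box_sweep {α : ℝ} (hα0 : 0 < α) (hα1 : α < 1) (c : EuclideanSpace ℝ (Fin n))
    (r : ℝ) {χ : Fin n → ℝ → ℝ} (hχ : ∀ k, ContDiff ℝ ∞ (χ k))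
    (hχ0 : ∀ k t, r < |t - c k| → χ k t = 0) (hχ1 : ∀ k, ∫ t, χ k t = 1) (m : ℕ) (hm : m ≤ n) :
    ∃ C : ℝ, 0 ≤ C ∧ ∀ (p q : Prop) (B : ℝ) (f : EuclideanSpace ℝ (Fin n) → ℝ),
      Ctrl α p q B f → (∀ x ∉ box c r, f x = 0) →
      ∃ (v : Fin n → EuclideanSpace ℝ (Fin n) → ℝ) (g : EuclideanSpace ℝ (Fin n) → ℝ),
        (∀ j, Ctrl α p q (C * B) (v j)) ∧ (∀ j, ∀ x ∉ box c r, v j x = 0) ∧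
        Ctrl α p q (C * B) g ∧ (∀ x ∉ box c r, g x = 0) ∧
        (∀ x, ∑ j, fderiv ℝ (v j) x (coordVec j) = f x - g x) ∧
        ∀ x y : EuclideanSpace ℝ (Fin n), (∀ j : Fin n, m ≤ j → x j = y j) →
          g x * ∏ j with j.val < m, χ j (y j) = g y * ∏ j with j.val < m, χ j (x j) := by
  induction m with
  | zero =>
    refine ⟨1, zero_le_one, fun p q B f hf hf0 => ⟨fun _ _ => 0, f, fun j => ?_, by simp, ?_, hf0,
      by simp, fun x y hxy => ?_⟩⟩
    · exact Ctrl.zero α p q (by simpa using hf.nonneg)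
    · simpa using hf
    · have : x = y := by
        ext j
        exact hxy j (Nat.zero_le _)
      subst this
      rfl
  | succ m ih =>
    obtain ⟨C, hC, h⟩ := ih (Nat.le_of_succ_le hm)
    set k : Fin n := ⟨m, hm⟩ with hk
    obtain ⟨D, hD, h'⟩ := exists_box_step hα0 hα1 c r k (hχ k) (hχ0 k) (hχ1 k)
    refine ⟨C + D * C, by positivity, fun p q B f hf hf0 => ?_⟩
    have hB := hf.nonneg
    obtain ⟨v, g, hv, hv0, hg, hg0, hdiv, hprod⟩ := h p q B f hf hf0
    obtain ⟨u, hu, hu0, hg', hg'0, hdu⟩ := h' p q _ g hg hg0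
    have hle : D * (C * B) ≤ (C + D * C) * B := by nlinarith [mul_nonneg hC hB]
    have hle' : C * B ≤ (C + D * C) * B := by nlinarith [mul_nonneg (mul_nonneg hD hC) hB]
    classical
    refine ⟨fun j => if j = k then fun x => v j x + u x else v j, _, fun j => ?_, fun j x hx => ?_,
      hg'.mono hle, hg'0, fun x => ?_, fun x y hxy => ?_⟩
    · by_cases hj : j = k
      · simp only [hj, if_true]
        exact ((hv k).add hu).mono (by ring_nf; rfl)
      · simp only [hj, if_false]
        exact (hv j).mono hle'
    · by_cases hj : j = k
      · simp only [hj, if_true, hv0 k x hx, hu0 x hx, add_zero]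
      · simp only [hj, if_false, hv0 j x hx]
    · have h1 : ∀ j, fderiv ℝ (if j = k then fun x => v j x + u x else v j) x (coordVec j) =
          fderiv ℝ (v j) x (coordVec j) + if j = k then fderiv ℝ u x (coordVec k) else 0 := by
        intro j
        by_cases hj : j = k
        · subst hj
          simp only [if_true]
          rw [fderiv_fun_add ((hv _).contDiff.differentiable one_ne_zero x)
            (hu.contDiff.differentiable one_ne_zero x)]
          rfl
        · simp [hj]
      simp only [h1, Finset.sum_add_distrib, hdiv, Finset.sum_ite_eq', Finset.mem_univ, if_true, hdu]
      ring
    · have hfilter : (Finset.univ.filter fun j : Fin n => j.val < m + 1) =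
          insert k (Finset.univ.filter fun j : Fin n => j.val < m) := by
        ext j
        simp only [Finset.mem_filter, Finset.mem_univ, true_and, Finset.mem_insert, Fin.ext_iff, hk]
        omega
      have hnot : k ∉ Finset.univ.filter fun j : Fin n => j.val < m := by simp [hk]
      rw [hfilter, Finset.prod_insert hnot, Finset.prod_insert hnot]
      have key : lineInt univ (coordVec k) g x * ∏ j with j.val < m, χ j (y j) =
          lineInt univ (coordVec k) g y * ∏ j with j.val < m, χ j (x j) := by
        rw [← lineInt_univ_sub_smul (coordVec k) g x (x k - y k)]
        unfold lineInt
        rw [← integral_mul_const, ← integral_mul_const]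
        congr 1
        ext t
        have h1 := hprod (x - (x k - y k) • coordVec k - t • coordVec k) (y - t • coordVec k) ?_
        · have hprodx : ∏ j with j.val < m, χ j ((x - (x k - y k) • coordVec k - t • coordVec k) j) =
              ∏ j with j.val < m, χ j (x j) := by
            refine Finset.prod_congr rfl fun j hj => ?_
            have hjk : j ≠ k := fun h => hnot (h ▸ hj)
            rw [sub_smul_coordVec_apply_of_ne _ _ hjk, sub_smul_coordVec_apply_of_ne _ _ hjk]
          have hprody : ∏ j with j.val < m, χ j ((y - t • coordVec k) j) =
              ∏ j with j.val < m, χ j (y j) := by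
            refine Finset.prod_congr rfl fun j hj => ?_
            have hjk : j ≠ k := fun h => hnot (h ▸ hj)
            rw [sub_smul_coordVec_apply_of_ne _ _ hjk]
          rw [hprodx, hprody] at h1
          exact h1
        · intro j hj
          by_cases hjk : j = k
          · subst hjk
            simp only [sub_smul_coordVec_apply_self]
            ring
          · rw [sub_smul_coordVec_apply_of_ne _ _ hjk, sub_smul_coordVec_apply_of_ne _ _ hjk,
              sub_smul_coordVec_apply_of_ne _ _ hjk]
            refine hxy j ?_
            have : j.val ≠ m := fun h => hjk (Fin.ext h)
            omega
      calc _ = χ k (x k) * χ k (y k) *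
            (lineInt univ (coordVec k) g x * ∏ j with j.val < m, χ j (y j)) := by ring
        _ = _ := by rw [key]; ring

theorem integral_fderiv_apply_eq_zero {v : EuclideanSpace ℝ (Fin n) → ℝ} (hv : ContDiff ℝ 1 v)
    (hvc : HasCompactSupport v) (e : EuclideanSpace ℝ (Fin n)) : ∫ x, fderiv ℝ v x e = 0 := by
  have hd : Integrable (fun x => fderiv ℝ v x e) :=
    ((hv.continuous_fderiv one_ne_zero).clm_apply continuous_const).integrable_of_hasCompactSupport
      (hvc.fderiv_apply ℝ e)
  have h := integral_mul_fderiv_eq_neg_fderiv_mul_of_integrable (μ := volume) (f := fun _ => (1 : ℝ))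
    (g := v) (v := e) (by simp) (by simpa using hd)
    (by simpa using hv.continuous.integrable_of_hasCompactSupport hvc)
    (fun x _ => by fun_prop) (fun x _ => hv.differentiable one_ne_zero x)
  simpa using h

/-- `h` is a smooth bump in a box for which the divergence equation with right-hand side
`f - (∫ f) h` can be solved inside the box with `C¹` bounds. -/
structure BoxBump (α : ℝ) (c : EuclideanSpace ℝ (Fin n)) (r : ℝ)
    (h : EuclideanSpace ℝ (Fin n) → ℝ) : Prop where
  smooth : ContDiff ℝ ∞ h
  zero_off : ∀ x ∉ box c r, h x = 0
  solve : ∃ C : ℝ, 0 ≤ C ∧ ∀ (p q : Prop) (B : ℝ) (f : EuclideanSpace ℝ (Fin n) → ℝ),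
      Ctrl α p q B f → (∀ x ∉ box c r, f x = 0) →
      ∃ v : Fin n → EuclideanSpace ℝ (Fin n) → ℝ,
        (∀ j, Ctrl α p q (C * B) (v j)) ∧ (∀ j, ∀ x ∉ box c r, v j x = 0) ∧
        ∀ x, ∑ j, fderiv ℝ (v j) x (coordVec j) = f x - (∫ y, f y) * h x

theorem exists_boxBump {α : ℝ} (hα0 : 0 < α) (hα1 : α < 1) (c : EuclideanSpace ℝ (Fin n))
    {r : ℝ} (hr : 0 < r) : ∃ h : EuclideanSpace ℝ (Fin n) → ℝ, BoxBump α c r h := by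
  let φ : ∀ k : Fin n, ContDiffBump (c k) := fun k => ⟨r / 2, r, by positivity, by linarith⟩
  have hχ0 : ∀ k t, r < |t - c k| → (φ k).normed volume t = 0 := by
    intro k t ht
    by_contra hne
    have h1 : t ∈ Function.support ((φ k).normed volume) := hne
    rw [(φ k).support_normed_eq, mem_ball, Real.dist_eq] at h1
    exact absurd h1 (not_lt.2 ht.le)
  obtain ⟨C, hC, hsolve⟩ := exists_box_sweep hα0 hα1 c r (χ := fun k => (φ k).normed volume)
    (fun k => (φ k).contDiff_normed) hχ0 (fun k => (φ k).integral_normed) n le_rfl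
  let h : EuclideanSpace ℝ (Fin n) → ℝ := fun x => ∏ j, (φ j).normed volume (x j)
  have hh : ContDiff ℝ ∞ h :=
    contDiff_prod fun j _ => (φ j).contDiff_normed.comp (by fun_prop)
  have hh0 : ∀ x ∉ box c r, h x = 0 := by
    intro x hx
    simp only [box, mem_ofPred_eq, not_forall, not_le] at hx
    obtain ⟨j, hj⟩ := hx
    exact Finset.prod_eq_zero (Finset.mem_univ j) (hχ0 j _ hj)
  have hh1 : ∫ x, h x = 1 := by
    have h1 := (EuclideanSpace.volume_preserving_symm_measurableEquiv_toLp (Fin n)).symm.integral_comp'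
      (g := h)
    rw [← h1]
    have h2 := integral_fintype_prod_volume_eq_prod (𝕜 := ℝ) (fun k : Fin n => (φ k).normed volume)
    refine Eq.trans ?_ (h2.trans ?_)
    · rfl
    · exact Finset.prod_eq_one fun k _ => (φ k).integral_normed
  refine ⟨h, hh, hh0, C, hC, fun p q B f hf hf0 => ?_⟩
  obtain ⟨v, g, hv, hv0, hg, hg0, hdiv, hprod⟩ := hsolve p q B f hf hf0
  refine ⟨v, hv, hv0, fun x => ?_⟩
  have hcs : ∀ {w : EuclideanSpace ℝ (Fin n) → ℝ}, (∀ x ∉ box c r, w x = 0) →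
      HasCompactSupport w := fun hw => hasCompactSupport_of_norm_lt (eq_zero_of_norm_gt_of_box hw)
  have hgi : Integrable g := hg.contDiff.continuous.integrable_of_hasCompactSupport (hcs hg0)
  have hfi : Integrable f := hf.contDiff.continuous.integrable_of_hasCompactSupport (hcs hf0)
  have h_integ : ∫ y, f y = ∫ y, g y := by
    have h1 : ∫ y, (f y - g y) = 0 := by
      simp_rw [← hdiv]
      rw [integral_finsetSum]
      · exact Finset.sum_eq_zero fun j _ =>
          integral_fderiv_apply_eq_zero (hv j).contDiff (hcs (hv0 j)) _
      · exact fun j _ => (((hv j).contDiff.continuous_fderiv one_ne_zero).clm_apply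
          continuous_const).integrable_of_hasCompactSupport ((hcs (hv0 j)).fderiv_apply ℝ _)
    rw [integral_sub hfi hgi] at h1
    linarith
  have hgx : g x = (∫ y, g y) * h x := by
    have h1 : ∀ y, g x * h y = g y * h x := fun y => by
      have := hprod x y fun j hj => absurd j.isLt (not_lt.2 hj)
      simpa [Finset.filter_true_of_mem] using this
    have h2 : ∫ y, g x * h y = ∫ y, g y * h x := by simp_rw [h1]
    rwa [integral_const_mul, integral_mul_const, hh1, mul_one] at h2
  rw [hdiv, h_integ, ← hgx]

end Box

section Potential

variable {n : ℕ}

theorem trace_eq_sum_coord (A : EuclideanSpace ℝ (Fin n) →L[ℝ] EuclideanSpace ℝ (Fin n)) :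
    LinearMap.trace ℝ (EuclideanSpace ℝ (Fin n)) A.toLinearMap = ∑ j, (A (coordVec j)) j := by
  rw [LinearMap.trace_eq_sum_inner _ (EuclideanSpace.basisFun (Fin n) ℝ)]
  simp [EuclideanSpace.inner_single_left]

theorem clm_apply_eq_sum_coord (A : EuclideanSpace ℝ (Fin n) →L[ℝ] ℝ)
    (w : EuclideanSpace ℝ (Fin n)) : A w = ∑ j, A (coordVec j) * w j := by
  have h : w = ∑ j, w j • coordVec j := by
    simpa using ((EuclideanSpace.basisFun (Fin n) ℝ).sum_repr w).symm
  conv_lhs => rw [h]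
  simp [mul_comm]

theorem fderiv_coord {W : EuclideanSpace ℝ (Fin n) → EuclideanSpace ℝ (Fin n)}
    (hW : ContDiff ℝ 1 W) (j : Fin n) (x : EuclideanSpace ℝ (Fin n)) :
    fderiv ℝ (fun y => W y j) x =
      (EuclideanSpace.proj j : EuclideanSpace ℝ (Fin n) →L[ℝ] ℝ).comp (fderiv ℝ W x) :=
  ((EuclideanSpace.proj j : EuclideanSpace ℝ (Fin n) →L[ℝ] ℝ).hasFDerivAt.comp x
    (hW.differentiable one_ne_zero x).hasFDerivAt).fderiv

/-- A divergence-free field has zero pairing with the gradient of a compactly supported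
function. -/
theorem DivFree.integral_fderiv_apply {W : EuclideanSpace ℝ (Fin n) → EuclideanSpace ℝ (Fin n)}
    (hW : ContDiff ℝ 1 W) (hdiv : DivFree W) {ψ : EuclideanSpace ℝ (Fin n) → ℝ}
    (hψ : ContDiff ℝ 1 ψ) (hψc : HasCompactSupport ψ) : ∫ x, fderiv ℝ ψ x (W x) = 0 := by
  have hWj : ∀ j, ContDiff ℝ 1 (fun x => W x j) := fun j => by fun_prop
  have hcψ : ∀ j, Continuous fun x => fderiv ℝ ψ x (coordVec j) := fun j =>
    (hψ.continuous_fderiv one_ne_zero).clm_apply continuous_const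
  have hcW : ∀ j, Continuous fun x => fderiv ℝ (fun y => W y j) x (coordVec j) := fun j =>
    ((hWj j).continuous_fderiv one_ne_zero).clm_apply continuous_const
  have hi1 : ∀ j, Integrable fun x => W x j * fderiv ℝ ψ x (coordVec j) := fun j =>
    ((hWj j).continuous.mul (hcψ j)).integrable_of_hasCompactSupport
      (hψc.fderiv_apply ℝ (coordVec j)).mul_left
  have hi2 : ∀ j, Integrable fun x => fderiv ℝ (fun y => W y j) x (coordVec j) * ψ x := fun j =>
    ((hcW j).mul hψ.continuous).integrable_of_hasCompactSupport hψc.mul_left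
  have hparts : ∀ j, ∫ x, W x j * fderiv ℝ ψ x (coordVec j) =
      -∫ x, fderiv ℝ (fun y => W y j) x (coordVec j) * ψ x := fun j =>
    integral_mul_fderiv_eq_neg_fderiv_mul_of_integrable (hi2 j) (hi1 j)
      (((hWj j).continuous.mul hψ.continuous).integrable_of_hasCompactSupport hψc.mul_left)
      (fun x _ => (hWj j).differentiable one_ne_zero x)
      (fun x _ => hψ.differentiable one_ne_zero x)
  have h1 : ∀ x, fderiv ℝ ψ x (W x) = ∑ j, W x j * fderiv ℝ ψ x (coordVec j) := fun x => by
    rw [clm_apply_eq_sum_coord]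
    simp_rw [mul_comm]
  simp_rw [h1]
  rw [integral_finsetSum _ fun j _ => hi1 j]
  simp_rw [hparts]
  rw [Finset.sum_neg_distrib, ← integral_finsetSum _ fun j _ => hi2 j, neg_eq_zero]
  refine integral_eq_zero_of_ae (Eventually.of_forall fun x => ?_)
  have h2 := hdiv x
  rw [trace_eq_sum_coord] at h2
  simp only [← Finset.sum_mul, fderiv_coord hW]
  change (∑ j, (fderiv ℝ W x (coordVec j)) j) * ψ x = 0
  rw [h2, zero_mul]

/-- The pairing of a divergence-free field with a closed compactly supported form `φ dξ`
vanishes in dimension at least two. -/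
theorem DivFree.integral_mul_fderiv_apply (hn : 2 ≤ n)
    {W : EuclideanSpace ℝ (Fin n) → EuclideanSpace ℝ (Fin n)} (hW : ContDiff ℝ 1 W)
    (hdiv : DivFree W) {φ ξ : EuclideanSpace ℝ (Fin n) → ℝ} (hφ : ContDiff ℝ ∞ φ)
    (hξ : ContDiff ℝ ∞ ξ) (hξc : HasCompactSupport ξ)
    (hφξ : ∀ x, fderiv ℝ ξ x ≠ 0 → fderiv ℝ φ x = 0) :
    ∫ x, φ x * fderiv ℝ ξ x (W x) = 0 := by
  have hφ1 : ContDiff ℝ 1 φ := contDiff_infty.1 hφ 1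
  have hξ' : ContDiff ℝ 1 (fderiv ℝ ξ) := (contDiff_infty.1 hξ 2).fderiv_right (by norm_num)
  let η : EuclideanSpace ℝ (Fin n) → EuclideanSpace ℝ (Fin n) → ℝ :=
    fun w x => φ x * fderiv ℝ ξ x w
  have hη : ∀ w, ContDiff ℝ 1 (η w) := fun w => hφ1.mul (hξ'.clm_apply contDiff_const)
  obtain ⟨R, hR⟩ : ∃ R : ℝ, ∀ x, R < ‖x‖ → ξ x = 0 := by
    obtain ⟨R, hR⟩ := hξc.isCompact.isBounded.subset_closedBall 0
    refine ⟨R, fun x hx => ?_⟩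
    by_contra hne
    have := hR (subset_tsupport _ hne)
    rw [mem_closedBall_zero_iff] at this
    linarith
  have hηR : ∀ w x, R < ‖x‖ → η w x = 0 := fun w x hx => by
    simp [η, fderiv_eq_zero_of_norm_lt hR x hx]
  have hsymm : ∀ w z x, fderiv ℝ (η w) x z = fderiv ℝ (η z) x w := by
    intro w z x
    have hd : ∀ w z, fderiv ℝ (η w) x z =
        φ x * fderiv ℝ (fderiv ℝ ξ) x z w + fderiv ℝ φ x z * fderiv ℝ ξ x w := by
      intro w z
      have h1 : HasFDerivAt (fun x => fderiv ℝ ξ x w)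
          ((ContinuousLinearMap.apply ℝ ℝ w).comp (fderiv ℝ (fderiv ℝ ξ) x)) x :=
        (ContinuousLinearMap.apply ℝ ℝ w).hasFDerivAt.comp x
          (hξ'.differentiable one_ne_zero x).hasFDerivAt
      have h2 := (hφ1.differentiable one_ne_zero x).hasFDerivAt.mul h1
      rw [show fderiv ℝ (η w) x = _ from h2.fderiv]
      simp [mul_comm]
    have hs : IsSymmSndFDerivAt ℝ ξ x :=
      (contDiff_infty.1 hξ 2).contDiffAt.isSymmSndFDerivAt (by simp)
    rw [hd, hd, hs.eq]
    by_cases h0 : fderiv ℝ ξ x = 0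
    · simp [h0]
    · simp [hφξ x h0]
  let e₀ : EuclideanSpace ℝ (Fin n) := coordVec ⟨0, by omega⟩
  let e₁ : EuclideanSpace ℝ (Fin n) := coordVec ⟨1, by omega⟩
  have he₀ : ‖e₀‖ = 1 := norm_coordVec _
  have hψd : ∀ x w, fderiv ℝ (lineInt (Ioi 0) e₀ (η e₀)) x w = φ x * fderiv ℝ ξ x w := by
    intro x w
    rw [fderiv_lineInt_apply he₀ (hη e₀) (hηR e₀)]
    simp_rw [hsymm e₀ w]
    exact integral_Ioi_fderiv_line he₀ (hη w) (hηR w) x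
  have hT : ∀ x, lineInt univ e₀ (η e₀) x = 0 := by
    intro x
    have hconst : ∀ x, fderiv ℝ (lineInt univ e₀ (η e₀)) x = 0 := by
      intro x
      ext w
      rw [fderiv_lineInt_apply he₀ (hη e₀) (hηR e₀)]
      simp_rw [hsymm e₀ w]
      simpa using integral_fderiv_line he₀ (hη w) (hηR w) x
    rw [is_const_of_fderiv_eq_zero (differentiable_lineInt he₀ (hη e₀) (hηR e₀)) hconst x
      ((|R| + 1) • e₁)]
    refine integral_eq_zero_of_ae (Eventually.of_forall fun t => hηR _ _ ?_)
    have h1 : ((|R| + 1) • e₁ - t • e₀) ⟨1, by omega⟩ = |R| + 1 := by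
      simp [e₀, e₁]
    have h2 := PiLp.norm_apply_le ((|R| + 1) • e₁ - t • e₀) ⟨1, by omega⟩
    rw [h1, Real.norm_eq_abs] at h2
    have := le_abs_self R
    have := le_abs_self (|R| + 1)
    linarith
  have hψR : ∀ x, R < ‖x‖ → lineInt (Ioi 0) e₀ (η e₀) x = 0 := by
    intro x hx
    have hgrow : ∀ t : ℝ, t * inner ℝ x e₀ ≤ 0 → R < ‖x - t • e₀‖ := by
      intro t ht
      refine hx.trans_le ?_
      have h1 := norm_sub_sq_real x (t • e₀)
      rw [inner_smul_right] at h1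
      have h2 : ‖x‖ ^ 2 ≤ ‖x - t • e₀‖ ^ 2 := by nlinarith [sq_nonneg ‖t • e₀‖]
      exact le_of_sq_le_sq h2 (norm_nonneg _)
    rcases le_total (inner ℝ x e₀) 0 with h | h
    · refine setIntegral_eq_zero_of_forall_eq_zero fun t ht => hηR _ _ (hgrow t ?_)
      have : 0 < t := ht
      exact mul_nonpos_of_nonneg_of_nonpos this.le h
    · refine Eq.trans ?_ (hT x)
      unfold lineInt
      rw [Measure.restrict_univ]
      refine setIntegral_eq_integral_of_forall_compl_eq_zero fun t ht => hηR _ _ (hgrow t ?_)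
      have : t ≤ 0 := not_lt.1 ht
      exact mul_nonpos_of_nonpos_of_nonneg this h
  have h := hdiv.integral_fderiv_apply hW (contDiff_lineInt he₀ 1 (by simpa using hη e₀) (hηR e₀))
    (hasCompactSupport_of_norm_lt hψR)
  simpa only [hψd] using h

end Potential

section Chain

variable {n : ℕ} {ι : Type} [Fintype ι]

/-- The coefficient vectors `m` such that `∑ mᵢ hᵢ` is the divergence of a smooth field
vanishing off `S`. -/
def divSubmodule (S : Set (EuclideanSpace ℝ (Fin n))) (h : ι → EuclideanSpace ℝ (Fin n) → ℝ) :
    Submodule ℝ (ι → ℝ) where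
  carrier := {m | ∃ w : Fin n → EuclideanSpace ℝ (Fin n) → ℝ, (∀ j, ContDiff ℝ ∞ (w j)) ∧
    (∀ j, ∀ x ∉ S, w j x = 0) ∧
    ∀ x, ∑ j, fderiv ℝ (w j) x (coordVec j) = ∑ i, m i * h i x}
  zero_mem' := ⟨fun _ _ => 0, fun _ => contDiff_const, by simp, by simp⟩
  add_mem' := by
    rintro a b ⟨v, hv, hv0, hvd⟩ ⟨w, hw, hw0, hwd⟩
    refine ⟨fun j x => v j x + w j x, fun j => (hv j).add (hw j),
      fun j x hx => by simp [hv0 j x hx, hw0 j x hx], fun x => ?_⟩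
    have h1 : ∀ j, fderiv ℝ (fun x => v j x + w j x) x = fderiv ℝ (v j) x + fderiv ℝ (w j) x :=
      fun j => fderiv_fun_add ((hv j).differentiable (by simp) x)
        ((hw j).differentiable (by simp) x)
    simp [h1, Finset.sum_add_distrib, hvd, hwd, add_mul]
  smul_mem' := by
    rintro a b ⟨v, hv, hv0, hvd⟩
    refine ⟨fun j x => a * v j x, fun j => contDiff_const.mul (hv j),
      fun j x hx => by simp [hv0 j x hx], fun x => ?_⟩
    have h1 : ∀ j, fderiv ℝ (fun x => a * v j x) x = a • fderiv ℝ (v j) x :=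
      fun j => fderiv_const_mul ((hv j).differentiable (by simp) x) a
    simp [h1, ← Finset.mul_sum, hvd, mul_assoc]

theorem exists_ctrl_of_contDiff {E : Type} [NormedAddCommGroup E] [NormedSpace ℝ E] [ProperSpace E]
    {α : ℝ} (hα0 : 0 < α) (hα1 : α < 1) {w : E → ℝ} (hw : ContDiff ℝ ∞ w)
    (hwc : HasCompactSupport w) : ∃ B : ℝ, 0 ≤ B ∧ ∀ p q : Prop, Ctrl α p q B w := by
  obtain ⟨C, hC, h⟩ := exists_ctrl_smul hα0 hα1 hw hwc
  refine ⟨C, hC, fun p q => ?_⟩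
  simpa using h p q 1 (fun _ => (1 : ℝ)) zero_le_one contDiff_const (by simp)
    (fun _ R => ⟨0, le_rfl, by simp⟩)
    (fun _ => contDiff_const)

theorem divSubmodule.exists_ctrl {α : ℝ} (hα0 : 0 < α) (hα1 : α < 1)
    {S : Set (EuclideanSpace ℝ (Fin n))} (hS : Bornology.IsBounded S)
    (h : ι → EuclideanSpace ℝ (Fin n) → ℝ) :
    ∃ C : ℝ, 0 ≤ C ∧ ∀ m ∈ divSubmodule S h, ∀ p q : Prop,
      ∃ w : Fin n → EuclideanSpace ℝ (Fin n) → ℝ, (∀ j, Ctrl α p q (C * ‖m‖) (w j)) ∧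
        (∀ j, ∀ x ∉ S, w j x = 0) ∧
        ∀ x, ∑ j, fderiv ℝ (w j) x (coordVec j) = ∑ i, m i * h i x := by
  let b := Module.finBasis ℝ (divSubmodule S h)
  have hb : ∀ k, (b k : ι → ℝ) ∈ divSubmodule S h := fun k => (b k).2
  choose w hw hw0 hwd using hb
  obtain ⟨R, hR⟩ := hS.subset_closedBall 0
  have hc : ∀ k j, HasCompactSupport (w k j) := fun k j =>
    HasCompactSupport.intro (isCompact_closedBall 0 R) fun x hx => hw0 k j x fun h => hx (hR h)
  choose B hB hBc using fun k j => exists_ctrl_of_contDiff hα0 hα1 (hw k j) (hc k j)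
  let ℓ : ∀ k, divSubmodule S h →L[ℝ] ℝ := fun k => LinearMap.toContinuousLinearMap (b.coord k)
  refine ⟨∑ k, ∑ j, ‖ℓ k‖ * B k j, Finset.sum_nonneg fun k _ => Finset.sum_nonneg fun j _ =>
    mul_nonneg (ℓ k).opNorm_nonneg (hB k j), fun m hm p q => ?_⟩
  refine ⟨fun j x => ∑ k, ℓ k ⟨m, hm⟩ • w k j x, fun j => ?_, fun j x hx => ?_, fun x => ?_⟩
  · refine (Ctrl.sum Finset.univ fun k _ => (hBc k j p q).const_smul (ℓ k ⟨m, hm⟩)).mono ?_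
    rw [Finset.sum_mul]
    refine Finset.sum_le_sum fun k _ => ?_
    have h1 : |ℓ k ⟨m, hm⟩| ≤ ‖ℓ k‖ * ‖m‖ := (ℓ k).le_opNorm ⟨m, hm⟩
    calc |ℓ k ⟨m, hm⟩| * B k j ≤ ‖ℓ k‖ * ‖m‖ * B k j := mul_le_mul_of_nonneg_right h1 (hB k j)
      _ = ‖ℓ k‖ * B k j * ‖m‖ := by ring
      _ ≤ _ := by
        refine mul_le_mul_of_nonneg_right ?_ (norm_nonneg _)
        exact Finset.single_le_sum (f := fun j => ‖ℓ k‖ * B k j)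
          (fun j _ => mul_nonneg (ℓ k).opNorm_nonneg (hB k j)) (Finset.mem_univ j)
  · simp [hw0 _ j x hx]
  · have h1 : ∀ j, fderiv ℝ (fun x => ∑ k, ℓ k ⟨m, hm⟩ • w k j x) x =
        ∑ k, ℓ k ⟨m, hm⟩ • fderiv ℝ (w k j) x := fun j => by
      exact (HasFDerivAt.fun_sum fun k _ =>
        ((hw k j).differentiable (by simp) x).hasFDerivAt.const_smul (ℓ k ⟨m, hm⟩)).fderiv
    have h2 : ∀ i, m i = ∑ k, ℓ k ⟨m, hm⟩ * (b k : ι → ℝ) i := fun i => by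
      have h3 := congrArg (fun z : divSubmodule S h => (z : ι → ℝ) i) (b.sum_repr ⟨m, hm⟩)
      simp only [Submodule.coe_sum, Submodule.coe_smul, Finset.sum_apply, Pi.smul_apply,
        smul_eq_mul] at h3
      exact h3.symm
    simp only [h1]
    simp only [sum_apply, smul_apply, smul_eq_mul]
    rw [Finset.sum_comm]
    simp only [← Finset.mul_sum, hwd]
    simp only [Finset.mul_sum]
    rw [Finset.sum_comm]
    refine Finset.sum_congr rfl fun i _ => ?_
    rw [h2 i, Finset.sum_mul]
    simp only [mul_assoc]

theorem single_sub_single_mem_divSubmodule [DecidableEq ι] {α : ℝ} (hα0 : 0 < α) (hα1 : α < 1)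
    {c : ι → EuclideanSpace ℝ (Fin n)} {r : ι → ℝ}
    {h : ι → EuclideanSpace ℝ (Fin n) → ℝ} (hh : ∀ i, BoxBump α (c i) (r i) (h i)) {i j : ι}
    {x : EuclideanSpace ℝ (Fin n)} (hi : x ∈ interior (box (c i) (r i)))
    (hj : x ∈ interior (box (c j) (r j))) :
    (Pi.single i 1 - Pi.single j 1 : ι → ℝ) ∈ divSubmodule (⋃ i, box (c i) (r i)) h := by
  obtain ⟨ε, hε, hball⟩ := Metric.mem_nhds_iff.1
    (inter_mem (mem_interior_iff_mem_nhds.1 hi) (mem_interior_iff_mem_nhds.1 hj))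
  let φ : ContDiffBump x := ⟨ε / 2, ε, by positivity, by linarith⟩
  have hφ0 : ∀ y ∉ box (c i) (r i) ∩ box (c j) (r j), φ.normed volume y = 0 := by
    intro y hy
    by_contra hne
    have h1 : y ∈ Function.support (φ.normed volume) := hne
    rw [φ.support_normed_eq] at h1
    exact hy (hball h1)
  obtain ⟨B, -, hB⟩ := exists_ctrl_of_contDiff hα0 hα1 (φ.contDiff_normed (μ := volume))
    φ.hasCompactSupport_normed
  have key : ∀ k, (∀ y ∉ box (c k) (r k), φ.normed volume y = 0) →
      ∃ v : Fin n → EuclideanSpace ℝ (Fin n) → ℝ, (∀ l, ContDiff ℝ ∞ (v l)) ∧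
        (∀ l, ∀ y ∉ ⋃ i, box (c i) (r i), v l y = 0) ∧
        ∀ y, ∑ l, fderiv ℝ (v l) y (coordVec l) = φ.normed volume y - h k y := by
    intro k hk
    obtain ⟨C, -, hC⟩ := (hh k).solve
    obtain ⟨v, hv, hv0, hvd⟩ := hC True True B _ (hB True True) hk
    refine ⟨v, fun l => (hv l).smooth trivial,
      fun l y hy => hv0 l y fun h => hy (mem_iUnion.2 ⟨k, h⟩), fun y => ?_⟩
    rw [hvd, φ.integral_normed, one_mul]
  obtain ⟨v, hv, hv0, hvd⟩ := key i fun y hy => hφ0 y fun h => hy h.1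
  obtain ⟨w, hw, hw0, hwd⟩ := key j fun y hy => hφ0 y fun h => hy h.2
  refine ⟨fun l y => w l y - v l y, fun l => (hw l).sub (hv l),
    fun l y hy => by simp [hv0 l y hy, hw0 l y hy], fun y => ?_⟩
  have h1 : ∀ l, fderiv ℝ (fun x => w l x - v l x) y = fderiv ℝ (w l) y - fderiv ℝ (v l) y :=
    fun l => fderiv_fun_sub ((hw l).differentiable (by simp) y)
      ((hv l).differentiable (by simp) y)
  simp [h1, Finset.sum_sub_distrib, hvd, hwd, sub_mul, Pi.single_apply]

/-- The masses of a partition of the divergence of `ξ W` form a divergence vector. -/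
theorem masses_mem_divSubmodule (hn : 2 ≤ n) {α : ℝ} (hα0 : 0 < α) (hα1 : α < 1)
    {c : ι → EuclideanSpace ℝ (Fin n)} {r : ι → ℝ}
    {h : ι → EuclideanSpace ℝ (Fin n) → ℝ} (hh : ∀ i, BoxBump α (c i) (r i) (h i))
    {θ : ι → EuclideanSpace ℝ (Fin n) → ℝ} (hθ : ∀ i, ContDiff ℝ ∞ (θ i))
    (hθs : ∀ i, tsupport (θ i) ⊆ interior (box (c i) (r i)))
    {ξ : EuclideanSpace ℝ (Fin n) → ℝ} (hξ : ContDiff ℝ ∞ ξ) (hξc : HasCompactSupport ξ)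
    (hθξ : ∀ x, fderiv ℝ ξ x ≠ 0 → ∑ i, θ i x = 1)
    {W : EuclideanSpace ℝ (Fin n) → EuclideanSpace ℝ (Fin n)} (hW : ContDiff ℝ 1 W)
    (hdiv : DivFree W) :
    (fun i => ∫ x, θ i x * fderiv ℝ ξ x (W x)) ∈ divSubmodule (⋃ i, box (c i) (r i)) h := by
  classical
  by_contra hm
  obtain ⟨f, hf, hker⟩ := Submodule.exists_le_ker_of_notMem hm
  apply hf
  have hξ' : Continuous (fderiv ℝ ξ) := hξ.continuous_fderiv (by simp)
  have heq : ∀ {i j x}, x ∈ tsupport (θ i) → x ∈ tsupport (θ j) →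
      f (Pi.single i 1) = f (Pi.single j 1) := by
    intro i j x hi hj
    have h1 := hker (single_sub_single_mem_divSubmodule hα0 hα1 hh (hθs i hi) (hθs j hj))
    rwa [LinearMap.mem_ker, map_sub, sub_eq_zero] at h1
  have hφξ : ∀ x, fderiv ℝ ξ x ≠ 0 →
      fderiv ℝ (fun y => ∑ i, f (Pi.single i 1) * θ i y) x = 0 := by
    intro x hx
    obtain ⟨i₀, hi₀⟩ : ∃ i, θ i x ≠ 0 := by
      by_contra! hcon
      have := hθξ x hx
      simp [hcon] at this
    have hev : (fun y => ∑ i, f (Pi.single i 1) * θ i y) =ᶠ[𝓝 x]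
        fun _ => f (Pi.single i₀ 1) := by
      have hopen : ∀ᶠ y in 𝓝 x, fderiv ℝ ξ y ≠ 0 := hξ'.continuousAt.eventually_ne hx
      have hsupp : ∀ᶠ y in 𝓝 x, ∀ i, x ∉ tsupport (θ i) → θ i y = 0 := by
        rw [eventually_all]
        intro i
        by_cases hi : x ∈ tsupport (θ i)
        · exact Eventually.of_forall fun y hy => absurd hi hy
        · filter_upwards [(isClosed_tsupport (θ i)).isOpen_compl.mem_nhds hi] with y hy _
          exact image_eq_zero_of_notMem_tsupport hy
      filter_upwards [hopen, hsupp] with y hy hy'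
      have h1 : ∀ i, f (Pi.single i 1) * θ i y = f (Pi.single i₀ 1) * θ i y := by
        intro i
        by_cases hi : x ∈ tsupport (θ i)
        · rw [heq hi (subset_tsupport _ hi₀)]
        · rw [hy' i hi, mul_zero, mul_zero]
      rw [Finset.sum_congr rfl fun i _ => h1 i, ← Finset.mul_sum, hθξ y hy, mul_one]
    rw [hev.fderiv_eq]
    simp
  have hzero := hdiv.integral_mul_fderiv_apply hn hW
    (ContDiff.sum fun i _ => contDiff_const.mul (hθ i)) hξ hξc hφξ
  have h_integ : ∀ i, Integrable fun x => θ i x * fderiv ℝ ξ x (W x) := fun i =>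
    ((hθ i).continuous.mul (hξ'.clm_apply hW.continuous)).integrable_of_hasCompactSupport
      (HasCompactSupport.mul_left (HasCompactSupport.intro (hξc.fderiv ℝ).isCompact fun x hx => by
        simp [image_eq_zero_of_notMem_tsupport hx]))
  rw [LinearMap.pi_apply_eq_sum_univ f]
  refine Eq.trans ?_ hzero
  simp only [Finset.sum_mul, mul_assoc]
  rw [integral_finsetSum _ fun i _ => (h_integ i).const_mul _]
  simp only [integral_const_mul, smul_eq_mul]
  refine Finset.sum_congr rfl fun i _ => ?_
  rw [mul_comm]
  congr 2
  ext k
  simp [Pi.single_apply, eq_comm]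

end Chain

section Cutoff

open scoped Manifold

variable {n : ℕ}

theorem exists_smooth_cutoff {K U : Set (EuclideanSpace ℝ (Fin n))} (hK : IsCompact K)
    (hU : IsOpen U) (hKU : K ⊆ U) :
    ∃ ξ : EuclideanSpace ℝ (Fin n) → ℝ, ContDiff ℝ ∞ ξ ∧ HasCompactSupport ξ ∧ tsupport ξ ⊆ U ∧
      ∃ N, IsOpen N ∧ K ⊆ N ∧ ∀ x ∈ N, ξ x = 1 := by
  obtain ⟨t, ht, hKt, htU⟩ := exists_compact_between hK hU hKU
  obtain ⟨ξ, hξ1, hξ0, -⟩ := exists_contMDiffMap_one_nhds_of_subset_interior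
    (n := ⊤) 𝓘(ℝ, EuclideanSpace ℝ (Fin n)) hK.isClosed hKt
  obtain ⟨N, hN, hKN, hN1⟩ := mem_nhdsSet_iff_exists.1 hξ1
  have hsupp : tsupport ξ ⊆ t := closure_minimal
    (fun x hx => by_contra fun hxt => hx (hξ0 x hxt)) ht.isClosed
  exact ⟨ξ, ξ.contMDiff.contDiff, HasCompactSupport.intro ht hξ0, hsupp.trans htU, N, hN, hKN, hN1⟩

/-- A smooth partition of unity over a compact set subordinate to small boxes. -/
theorem exists_box_partition {L O : Set (EuclideanSpace ℝ (Fin n))} (hL : IsCompact L)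
    (hO : IsOpen O) (hLO : L ⊆ O) :
    ∃ (ι : Type) (_ : Fintype ι) (c : ι → EuclideanSpace ℝ (Fin n)) (r : ι → ℝ)
      (θ : ι → EuclideanSpace ℝ (Fin n) → ℝ), (∀ i, 0 < r i) ∧ (∀ i, box (c i) (r i) ⊆ O) ∧
      (∀ i, ContDiff ℝ ∞ (θ i)) ∧ (∀ i, tsupport (θ i) ⊆ interior (box (c i) (r i))) ∧
      ∀ x ∈ L, ∑ i, θ i x = 1 := by
  have hbox : ∀ x : L, ∃ r : ℝ, 0 < r ∧ box (x : EuclideanSpace ℝ (Fin n)) r ⊆ O := by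
    intro x
    obtain ⟨ε, hε, hball⟩ := Metric.isOpen_iff.1 hO x (hLO x.2)
    refine ⟨ε / (n + 1), by positivity, fun y hy => hball ?_⟩
    rw [mem_ball, dist_eq_norm]
    refine (norm_sub_le_of_mem_box hy).trans_lt ?_
    rw [mul_div_assoc', div_lt_iff₀ (by positivity)]
    nlinarith
  choose r hr hrO using hbox
  have hmem : ∀ x : L, (x : EuclideanSpace ℝ (Fin n)) ∈ interior (box (x : EuclideanSpace ℝ (Fin n)) (r x)) := by
    intro x
    refine mem_interior.2 ⟨ball x (r x), fun y hy j => ?_, isOpen_ball, mem_ball_self (hr x)⟩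
    rw [mem_ball, dist_eq_norm] at hy
    have := PiLp.norm_apply_le (y - (x : EuclideanSpace ℝ (Fin n))) j
    rw [Real.norm_eq_abs, PiLp.sub_apply] at this
    linarith
  obtain ⟨s, hs⟩ := hL.elim_finite_subcover (fun x : L => interior (box (x : EuclideanSpace ℝ (Fin n)) (r x)))
    (fun _ => isOpen_interior) fun x hx => mem_iUnion.2 ⟨⟨x, hx⟩, hmem ⟨x, hx⟩⟩
  obtain ⟨θ, hθ⟩ := SmoothPartitionOfUnity.exists_isSubordinate 𝓘(ℝ, EuclideanSpace ℝ (Fin n))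
    hL.isClosed (fun i : s => interior (box (i : EuclideanSpace ℝ (Fin n)) (r i)))
    (fun _ => isOpen_interior) fun x hx => by
      obtain ⟨i, hi, hxi⟩ := mem_iUnion₂.1 (hs hx)
      exact mem_iUnion.2 ⟨⟨i, hi⟩, hxi⟩
  refine ⟨s, inferInstance, fun i => i, fun i => r i, fun i => θ i, fun i => hr i, fun i => hrO i,
    fun i => (θ i).contMDiff.contDiff, hθ, fun x hx => ?_⟩
  have := θ.sum_eq_one hx
  rwa [finsum_eq_sum_of_fintype] at this

/-- The divergence equation `div v = dξ(W)` for divergence-free `W`, solved near the support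
of `dξ`. -/
theorem exists_solve_div {ι : Type} [Fintype ι] (hn : 2 ≤ n) {α : ℝ} (hα0 : 0 < α) (hα1 : α < 1)
    {c : ι → EuclideanSpace ℝ (Fin n)} {r : ι → ℝ} (hr : ∀ i, 0 < r i)
    {θ : ι → EuclideanSpace ℝ (Fin n) → ℝ} (hθ : ∀ i, ContDiff ℝ ∞ (θ i))
    (hθs : ∀ i, tsupport (θ i) ⊆ interior (box (c i) (r i)))
    {ξ : EuclideanSpace ℝ (Fin n) → ℝ} (hξ : ContDiff ℝ ∞ ξ) (hξc : HasCompactSupport ξ)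
    (hθξ : ∀ x, fderiv ℝ ξ x ≠ 0 → ∑ i, θ i x = 1) :
    ∃ C : ℝ, 0 ≤ C ∧ ∀ (p q : Prop) (δ : ℝ) (W : EuclideanSpace ℝ (Fin n) → EuclideanSpace ℝ (Fin n)),
      0 ≤ δ → ContDiff ℝ 1 W → DivFree W →
      (∀ x ∈ tsupport ξ, ‖W x‖ ≤ δ ∧ ‖fderiv ℝ W x‖ ≤ δ) →
      (p → LocHolder α (fderiv ℝ W)) → (q → ContDiff ℝ ∞ W) →
      ∃ v : Fin n → EuclideanSpace ℝ (Fin n) → ℝ, (∀ j, Ctrl α p q (C * δ) (v j)) ∧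
        (∀ j, ∀ x ∉ ⋃ i, box (c i) (r i), v j x = 0) ∧
        ∀ x, ∑ j, fderiv ℝ (v j) x (coordVec j) = fderiv ℝ ξ x (W x) := by
  choose h hh using fun i => exists_boxBump hα0 hα1 (c i) (hr i)
  choose Cs hCs hsolve using fun i => (hh i).solve
  have hbdd : Bornology.IsBounded (⋃ i, box (c i) (r i)) := by
    rw [Bornology.isBounded_iUnion]
    refine fun i => (isBounded_closedBall (x := c i) (r := n * r i)).subset fun x hx => ?_
    rw [mem_closedBall, dist_eq_norm]
    exact norm_sub_le_of_mem_box hx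
  obtain ⟨Cd, hCd, hdivsub⟩ := divSubmodule.exists_ctrl hα0 hα1 hbdd h
  have hξ' : ContDiff ℝ ∞ (fderiv ℝ ξ) := hξ.fderiv_right (by simp)
  have hχsub : ∀ i j, tsupport (fun x => θ i x * fderiv ℝ ξ x (coordVec j)) ⊆ tsupport ξ :=
    fun i j => (tsupport_mul_subset_right).trans (tsupport_fderiv_apply_subset ℝ _)
  choose Cm hCm hmul using fun i j => exists_ctrl_smul hα0 hα1
    ((hθ i).mul (hξ'.clm_apply (contDiff_const (c := coordVec j))))
    (hξc.isCompact.of_isClosed_subset (isClosed_tsupport _) (hχsub i j))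
  set Cg : ι → ℝ := fun i => ∑ j, Cm i j with hCg
  have hCg0 : ∀ i, 0 ≤ Cg i := fun i => Finset.sum_nonneg fun j _ => hCm i j
  set vol : ℝ := volume.real (tsupport ξ) with hvol
  have hvol0 : 0 ≤ vol := measureReal_nonneg
  refine ⟨∑ i, Cs i * Cg i + Cd * ((∑ i, Cg i) * vol), ?_, ?_⟩
  · have h1 : 0 ≤ ∑ i, Cs i * Cg i := Finset.sum_nonneg fun i _ => mul_nonneg (hCs i) (hCg0 i)
    have h2 : 0 ≤ ∑ i, Cg i := Finset.sum_nonneg fun i _ => hCg0 i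
    positivity
  intro p q δ W hδ hW hdiv hWδ hWp hWq
  let P : Fin n → EuclideanSpace ℝ (Fin n) →L[ℝ] ℝ := fun j => EuclideanSpace.proj j
  have hPn : ∀ j, ‖P j‖ ≤ 1 := fun j =>
    ContinuousLinearMap.opNorm_le_bound _ zero_le_one fun x => by
      simpa [P] using PiLp.norm_apply_le x j
  have hdW : ∀ j, fderiv ℝ (fun x => W x j) = fun x => (P j).comp (fderiv ℝ W x) := fun j =>
    funext fun x => fderiv_coord hW j x
  have hg : ∀ i, Ctrl α p q (Cg i * δ) (fun x => θ i x * fderiv ℝ ξ x (W x)) := by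
    intro i
    have h1 : ∀ j, Ctrl α p q (Cm i j * δ)
        (fun x => (θ i x * fderiv ℝ ξ x (coordVec j)) • W x j) := by
      intro j
      refine hmul i j p q δ (fun x => W x j) hδ (by fun_prop) (fun x hx => ?_) (fun hp => ?_)
        (fun hq => ?_)
      · obtain ⟨h1, h2⟩ := hWδ x (hχsub i j hx)
        refine ⟨(PiLp.norm_apply_le (W x) j).trans h1, ?_⟩
        rw [hdW]
        refine ((P j).opNorm_comp_le _).trans ?_
        exact (mul_le_of_le_one_left (norm_nonneg _) (hPn j)).trans h2
      · rw [hdW]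
        exact (hWp hp).clm (ContinuousLinearMap.compL ℝ _ _ _ (P j))
      · have := hWq hq
        fun_prop
    have h2 := Ctrl.sum Finset.univ fun j _ => h1 j
    rw [← Finset.sum_mul] at h2
    convert h2 using 2 with x
    rw [clm_apply_eq_sum_coord, Finset.mul_sum]
    simp only [smul_eq_mul, mul_assoc]
  have hg0 : ∀ i, ∀ x ∉ box (c i) (r i), θ i x * fderiv ℝ ξ x (W x) = 0 := by
    intro i x hx
    rw [image_eq_zero_of_notMem_tsupport fun h => hx (interior_subset (hθs i h)), zero_mul]
  choose v hv hv0 hvd using fun i => hsolve i p q _ _ (hg i) (hg0 i)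
  set m : ι → ℝ := fun i => ∫ x, θ i x * fderiv ℝ ξ x (W x) with hm
  have hmn : ‖m‖ ≤ (∑ i, Cg i) * vol * δ := by
    rw [pi_norm_le_iff_of_nonneg
      (mul_nonneg (mul_nonneg (Finset.sum_nonneg fun i _ => hCg0 i) hvol0) hδ)]
    intro i
    have h1 : m i = ∫ x in tsupport ξ, θ i x * fderiv ℝ ξ x (W x) := by
      refine (setIntegral_eq_integral_of_forall_compl_eq_zero fun x hx => ?_).symm
      rw [image_eq_zero_of_notMem_tsupport fun h => hx (tsupport_fderiv_subset ℝ h)]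
      simp
    rw [h1]
    refine (norm_setIntegral_le_of_norm_le_const hξc.isCompact.measure_lt_top
      fun x _ => (hg i).bound x).trans ?_
    have h2 : Cg i ≤ ∑ i, Cg i := Finset.single_le_sum (fun i _ => hCg0 i) (Finset.mem_univ i)
    calc Cg i * δ * vol ≤ (∑ i, Cg i) * δ * vol := by gcongr
      _ = _ := by ring
  obtain ⟨w, hw, hw0, hwd⟩ := hdivsub m
    (masses_mem_divSubmodule hn hα0 hα1 hh hθ hθs hξ hξc hθξ hW hdiv) p q
  refine ⟨fun j x => ∑ i, v i j x + w j x, fun j => ?_, fun j x hx => ?_, fun x => ?_⟩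
  · refine ((Ctrl.sum Finset.univ fun i _ => hv i j).add (hw j)).mono ?_
    have : Cd * ‖m‖ ≤ Cd * ((∑ i, Cg i) * vol * δ) := by gcongr
    rw [add_mul, Finset.sum_mul]
    simp only [mul_assoc] at this ⊢
    linarith
  · rw [mem_iUnion, not_exists] at hx
    simp only [fun i => hv0 i j x (hx i), hw0 j x (by simpa using hx), Finset.sum_const_zero,
      add_zero]
  · have h1 : ∀ j, fderiv ℝ (fun x => ∑ i, v i j x + w j x) x =
        ∑ i, fderiv ℝ (v i j) x + fderiv ℝ (w j) x := fun j =>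
      ((HasFDerivAt.fun_sum fun i _ =>
        ((hv i j).contDiff.differentiable one_ne_zero x).hasFDerivAt).add
        ((hw j).contDiff.differentiable one_ne_zero x).hasFDerivAt).fderiv
    simp only [h1]
    simp only [add_apply, sum_apply, Finset.sum_add_distrib, hwd]
    rw [Finset.sum_comm]
    simp only [hvd, Finset.sum_sub_distrib, ← Finset.sum_mul]
    rw [show ∑ i, (∫ y, θ i y * fderiv ℝ ξ y (W y)) * h i x = ∑ i, m i * h i x from rfl,
      sub_add_cancel]
    by_cases h0 : fderiv ℝ ξ x = 0
    · simp [h0]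
    · rw [hθξ x h0, one_mul]

/-- A divergence-free field that is `C¹`-small on `U` can be cut off near `K` inside the class
of divergence-free fields, with a linear loss. -/
theorem exists_divFree_cutoff (hn : 2 ≤ n) {α : ℝ} (hα0 : 0 < α) (hα1 : α < 1)
    {K U : Set (EuclideanSpace ℝ (Fin n))} (hK : IsCompact K) (hU : IsOpen U) (hKU : K ⊆ U) :
    ∃ (C : ℝ) (V : Set (EuclideanSpace ℝ (Fin n))), 0 ≤ C ∧ IsOpen V ∧ K ⊆ V ∧ V ⊆ U ∧
      ∀ (p q : Prop) (δ : ℝ) (W : EuclideanSpace ℝ (Fin n) → EuclideanSpace ℝ (Fin n)),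
        0 ≤ δ → ContDiff ℝ 1 W → DivFree W →
        (∀ x ∈ U, ‖W x‖ ≤ δ ∧ ‖fderiv ℝ W x‖ ≤ δ) →
        (p → LocHolder α (fderiv ℝ W)) → (q → ContDiff ℝ ∞ W) →
        ∃ Z : EuclideanSpace ℝ (Fin n) → EuclideanSpace ℝ (Fin n),
          Ctrl α p q (C * δ) Z ∧ DivFree Z ∧ (∀ x ∈ V, Z x = W x) ∧
          ∃ R : ℝ, ∀ x, R < ‖x‖ → Z x = 0 := by
  obtain ⟨ξ, hξ, hξc, hξU, N, hN, hKN, hξ1⟩ := exists_smooth_cutoff hK hU hKU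
  have hKO : tsupport (fderiv ℝ ξ) ⊆ Kᶜ := by
    intro x hx hxK
    refine notMem_tsupport_iff_eventuallyEq.2 ?_ hx
    have hev : ξ =ᶠ[𝓝 x] fun _ => 1 := by
      filter_upwards [hN.mem_nhds (hKN hxK)] with y hy using hξ1 y hy
    filter_upwards [hev.fderiv (𝕜 := ℝ)] with y hy
    rw [hy]
    simp
  obtain ⟨ι, hι, c, r, θ, hr, hrO, hθ, hθs, hθ1⟩ :=
    exists_box_partition (hξc.fderiv ℝ).isCompact hK.isClosed.isOpen_compl hKO
  obtain ⟨Cv, hCv, hsolve⟩ := exists_solve_div hn hα0 hα1 hr hθ hθs hξ hξc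
    fun x hx => hθ1 x (subset_tsupport _ hx)
  obtain ⟨Cξ, hCξ, hmul⟩ := exists_ctrl_smul hα0 hα1 hξ hξc
  have hclosed : IsClosed (⋃ i, box (c i) (r i)) :=
    isClosed_iUnion_of_finite fun i => isClosed_box _ _
  refine ⟨Cξ + n * Cv, U ∩ N ∩ (⋃ i, box (c i) (r i))ᶜ, by positivity,
    (hU.inter hN).inter hclosed.isOpen_compl, fun x hx => ⟨⟨hKU hx, hKN hx⟩, fun hxb => ?_⟩,
    fun x hx => hx.1.1, ?_⟩
  · obtain ⟨i, hi⟩ := mem_iUnion.1 hxb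
    exact hrO i hi hx
  intro p q δ W hδ hW hdiv hWδ hWp hWq
  have hWξ : ∀ x ∈ tsupport ξ, ‖W x‖ ≤ δ ∧ ‖fderiv ℝ W x‖ ≤ δ := fun x hx => hWδ x (hξU hx)
  obtain ⟨v, hv, hv0, hvd⟩ := hsolve p q δ W hδ hW hdiv hWξ hWp hWq
  have hξW : Ctrl α p q (Cξ * δ) (fun x => ξ x • W x) := hmul p q δ W hδ hW hWξ hWp hWq
  have hvv : ∀ j, Ctrl α p q (Cv * δ) (fun x => v j x • coordVec j) := fun j => by
    have h := (hv j).clm (ContinuousLinearMap.toSpanSingleton ℝ (coordVec j))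
    simpa [ContinuousLinearMap.norm_toSpanSingleton] using h
  have hZ := hξW.sub (Ctrl.sum Finset.univ fun j _ => hvv j)
  refine ⟨fun x => ξ x • W x - ∑ j, v j x • coordVec j, hZ.mono (le_of_eq ?_), fun x => ?_,
    fun x hx => ?_, ?_⟩
  · rw [Finset.sum_const, Finset.card_univ, Fintype.card_fin, nsmul_eq_mul]
    ring
  · have hd : HasFDerivAt (fun x => ξ x • W x - ∑ j, v j x • coordVec j)
        (ξ x • fderiv ℝ W x + (fderiv ℝ ξ x).smulRight (W x) -
          ∑ j, (fderiv ℝ (v j) x).smulRight (coordVec j)) x :=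
      ((hξ.differentiable (by simp) x).hasFDerivAt.smul
        (hW.differentiable one_ne_zero x).hasFDerivAt).sub (HasFDerivAt.fun_sum fun j _ =>
        ((hv j).contDiff.differentiable one_ne_zero x).hasFDerivAt.smul_const (coordVec j))
    have hW0 := hdiv x
    rw [trace_eq_sum_coord] at hW0 ⊢
    rw [hd.fderiv]
    have h1 := clm_apply_eq_sum_coord (fderiv ℝ ξ x) (W x)
    have h2 := hvd x
    simp only [sub_apply, add_apply, smul_apply, sum_apply, ContinuousLinearMap.smulRight_apply,
      PiLp.sub_apply, PiLp.add_apply, PiLp.smul_apply, smul_eq_mul, Finset.sum_sub_distrib,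
      Finset.sum_add_distrib, ← Finset.mul_sum, hW0, ← h1, ← h2]
    simp [Pi.single_apply]
  · simp [hξ1 x hx.1.2, hv0 _ x hx.2]
  · have hb : Bornology.IsBounded (tsupport ξ ∪ ⋃ i, box (c i) (r i)) := by
      refine hξc.isCompact.isBounded.union ((Bornology.isBounded_iUnion).2 fun i =>
        (isBounded_closedBall (x := c i) (r := n * r i)).subset fun x hx => ?_)
      rw [mem_closedBall, dist_eq_norm]
      exact norm_sub_le_of_mem_box hx
    obtain ⟨R, hR⟩ := hb.subset_closedBall 0
    refine ⟨R, fun x hx => ?_⟩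
    have hnot : x ∉ tsupport ξ ∪ ⋃ i, box (c i) (r i) := fun h => by
      have := hR h
      rw [mem_closedBall_zero_iff] at this
      linarith
    rw [mem_union, not_or] at hnot
    simp [image_eq_zero_of_notMem_tsupport hnot.1, hv0 _ x hnot.2]

end Cutoff

section Mollify

open scoped Convolution

variable {n : ℕ}

theorem hasFDerivAt_convolution_of_bounded {E F : Type*} [NormedAddCommGroup E] [NormedSpace ℝ E]
    [FiniteDimensional ℝ E] [MeasurableSpace E] [BorelSpace E] [NormedAddCommGroup F]
    [NormedSpace ℝ F] [CompleteSpace F] {μ : Measure E} [IsFiniteMeasureOnCompacts μ] {φ : E → ℝ}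
    (hφ : Continuous φ) (hφc : HasCompactSupport φ) {X : E → F} (hX : ContDiff ℝ 1 X) {M : ℝ}
    (hM : ∀ x, ‖fderiv ℝ X x‖ ≤ M) (x : E) :
    HasFDerivAt (φ ⋆[ContinuousLinearMap.lsmul ℝ ℝ, μ] X : E → F)
      (∫ t, φ t • fderiv ℝ X (x - t) ∂μ) x := by
  have hX' := hX.continuous_fderiv one_ne_zero
  refine hasFDerivAt_integral_of_dominated_of_fderiv_le (bound := fun t => ‖φ t‖ * M)
    (F := fun y t => φ t • X (y - t)) (F' := fun y t => φ t • fderiv ℝ X (y - t)) univ_mem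
    (Eventually.of_forall fun y => ?_) ?_ ?_ (Eventually.of_forall fun t y _ => ?_) ?_
    (Eventually.of_forall fun t y _ => ?_)
  · exact (hφ.smul (hX.continuous.comp (by fun_prop))).aestronglyMeasurable
  · exact (hφ.smul (hX.continuous.comp (by fun_prop))).integrable_of_hasCompactSupport
      hφc.smul_right
  · exact (hφ.smul (hX'.comp (by fun_prop))).aestronglyMeasurable
  · rw [norm_smul]
    exact mul_le_mul_of_nonneg_left (hM _) (norm_nonneg _)
  · exact (hφ.integrable_of_hasCompactSupport hφc).norm.mul_const M
  · exact ((hX.differentiable one_ne_zero (y - t)).hasFDerivAt.comp y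
      ((hasFDerivAt_id y).sub_const t)).const_smul (φ t)

theorem exists_lipschitz_convolution {E F : Type*} [NormedAddCommGroup E] [NormedSpace ℝ E]
    [FiniteDimensional ℝ E] [MeasurableSpace E] [BorelSpace E] [NormedAddCommGroup F]
    [NormedSpace ℝ F] [CompleteSpace F] {μ : Measure E} [μ.IsAddHaarMeasure] {φ : E → ℝ}
    (hφ : ContDiff ℝ 1 φ) (hφc : HasCompactSupport φ) {g : E → F} (hg : Continuous g) {M : ℝ}
    (hM : ∀ x, ‖g x‖ ≤ M) :
    ∃ L : ℝ, 0 ≤ L ∧ ∀ x y, ‖(φ ⋆[ContinuousLinearMap.lsmul ℝ ℝ, μ] g : E → F) x -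
      (φ ⋆[ContinuousLinearMap.lsmul ℝ ℝ, μ] g : E → F) y‖ ≤ L * ‖x - y‖ := by
  have hM0 : 0 ≤ M := (norm_nonneg _).trans (hM 0)
  have hd : ∀ x, HasFDerivAt (φ ⋆[ContinuousLinearMap.lsmul ℝ ℝ, μ] g : E → F)
      ((fderiv ℝ φ ⋆[(ContinuousLinearMap.lsmul ℝ ℝ).precompL E, μ] g) x) x := fun x =>
    hφc.hasFDerivAt_convolution_left _ hφ hg.locallyIntegrable x
  have hφi : Integrable (fun t => ‖fderiv ℝ φ t‖) μ :=
    ((hφ.continuous_fderiv one_ne_zero).integrable_of_hasCompactSupport (hφc.fderiv ℝ)).norm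
  refine ⟨∫ t, ‖fderiv ℝ φ t‖ * M ∂μ, integral_nonneg fun t => mul_nonneg (norm_nonneg _) hM0,
    fun x y => convex_univ.norm_image_sub_le_of_norm_hasFDerivWithin_le
      (fun z _ => (hd z).hasFDerivWithinAt) (fun z _ => ?_) (mem_univ y) (mem_univ x)⟩
  refine norm_integral_le_of_norm_le (hφi.mul_const M) (Eventually.of_forall fun t => ?_)
  have h1 : (ContinuousLinearMap.lsmul ℝ ℝ : ℝ →L[ℝ] F →L[ℝ] F).precompL E (fderiv ℝ φ t)
      (g (z - t)) = (fderiv ℝ φ t).smulRight (g (z - t)) := by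
    ext w
    simp [ContinuousLinearMap.precompL_apply]
  rw [h1, ContinuousLinearMap.norm_smulRight_apply]
  exact mul_le_mul_of_nonneg_left (hM _) (norm_nonneg _)

theorem exists_holder_of_bounded_of_lipschitz {E F : Type*} [NormedAddCommGroup E]
    [NormedAddCommGroup F] {α : ℝ} (hα0 : 0 < α) (hα1 : α < 1) {u : E → F} {M L : ℝ}
    (hM : ∀ x, ‖u x‖ ≤ M) (hL0 : 0 ≤ L) (hL : ∀ x y, ‖u x - u y‖ ≤ L * ‖x - y‖) :
    ∃ C : ℝ, 0 ≤ C ∧ ∀ x y, ‖u x - u y‖ ≤ C * ‖x - y‖ ^ α := by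
  have hM0 : 0 ≤ M := (norm_nonneg _).trans (hM 0)
  refine ⟨L + 2 * M, by positivity, fun x y => ?_⟩
  have hα : 0 ≤ ‖x - y‖ ^ α := by positivity
  rcases le_total ‖x - y‖ 1 with h | h
  · have h1 : ‖x - y‖ ≤ ‖x - y‖ ^ α := by
      simpa using norm_le_rpow_mul hα0 hα1 (norm_nonneg (x - y)) h
    nlinarith [hL x y]
  · have h1 : 1 ≤ ‖x - y‖ ^ α := Real.one_le_rpow h hα0.le
    nlinarith [norm_sub_le (u x) (u y), hM x, hM y]

/-- Uniform `C¹` approximation of a divergence-free field by smooth ones. -/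
theorem exists_smooth_divFree_approx {α : ℝ} (hα0 : 0 < α) (hα1 : α < 1)
    {X : EuclideanSpace ℝ (Fin n) → EuclideanSpace ℝ (Fin n)} (hX : ContDiff ℝ 1 X)
    (hdiv : DivFree X) {M : ℝ} (hM : ∀ x, ‖fderiv ℝ X x‖ ≤ M)
    (huc : UniformContinuous fun x => fderiv ℝ X x) {ε : ℝ} (hε : 0 < ε) :
    ∃ X' : EuclideanSpace ℝ (Fin n) → EuclideanSpace ℝ (Fin n), ContDiff ℝ ∞ X' ∧ DivFree X' ∧
      C1Holder α X' ∧ ∀ x, ‖X' x - X x‖ ≤ ε ∧ ‖fderiv ℝ X' x - fderiv ℝ X x‖ ≤ ε := by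
  have hM0 : 0 ≤ M := (norm_nonneg _).trans (hM 0)
  have hX' := hX.continuous_fderiv one_ne_zero
  obtain ⟨ρ, hρ, hucρ⟩ := Metric.uniformContinuous_iff.1 huc ε hε
  set s : ℝ := min ρ (ε / (M + 1)) with hs
  have hs0 : 0 < s := lt_min hρ (by positivity)
  let φ : ContDiffBump (0 : EuclideanSpace ℝ (Fin n)) :=
    ⟨s / 2, s, by positivity, by linarith⟩
  have hφs : ContDiff ℝ ∞ (φ.normed volume) := φ.contDiff_normed
  have hφc : HasCompactSupport (φ.normed volume) := φ.hasCompactSupport_normed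
  set X' : EuclideanSpace ℝ (Fin n) → EuclideanSpace ℝ (Fin n) :=
    (φ.normed volume ⋆[ContinuousLinearMap.lsmul ℝ ℝ, volume] X) with hX'def
  set D : EuclideanSpace ℝ (Fin n) → EuclideanSpace ℝ (Fin n) →L[ℝ] EuclideanSpace ℝ (Fin n) :=
    (φ.normed volume ⋆[ContinuousLinearMap.lsmul ℝ ℝ, volume] fderiv ℝ X) with hD
  have hd : ∀ x, HasFDerivAt X' (D x) x := fun x =>
    hasFDerivAt_convolution_of_bounded hφs.continuous hφc hX hM x
  have hfd : fderiv ℝ X' = D := funext fun x => (hd x).fderiv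
  have hsm : ContDiff ℝ ∞ X' :=
    hφc.contDiff_convolution_left _ hφs hX.continuous.locallyIntegrable
  have hDX : ∀ x, ‖D x - fderiv ℝ X x‖ ≤ ε := by
    intro x
    rw [← dist_eq_norm]
    refine φ.dist_normed_convolution_le hX'.aestronglyMeasurable fun y hy => ?_
    exact (hucρ ((mem_ball.1 hy).trans_le (min_le_left _ _))).le
  have hDM : ∀ x, ‖D x‖ ≤ M + ε := fun x => by
    have := norm_le_norm_add_norm_sub' (D x) (fderiv ℝ X x)
    linarith [hM x, hDX x]
  obtain ⟨L, hL0, hL⟩ := exists_lipschitz_convolution (μ := volume) (hφs.of_le (by simp)) hφc hX' hM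
  refine ⟨X', hsm, fun x => ?_, ⟨hsm.of_le (by simp), ?_⟩, fun x => ⟨?_, ?_⟩⟩
  · let T : (EuclideanSpace ℝ (Fin n) →L[ℝ] EuclideanSpace ℝ (Fin n)) →L[ℝ] ℝ :=
      LinearMap.toContinuousLinearMap
        ((LinearMap.trace ℝ (EuclideanSpace ℝ (Fin n))).comp (ContinuousLinearMap.coeLM ℝ))
    have hi : Integrable fun t => φ.normed volume t • fderiv ℝ X (x - t) :=
      (hφs.continuous.smul (hX'.comp (by fun_prop))).integrable_of_hasCompactSupport hφc.smul_right
    rw [hfd]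
    change T (∫ t, φ.normed volume t • fderiv ℝ X (x - t)) = 0
    rw [← T.integral_comp_comm hi]
    have h0 : ∀ y, T (fderiv ℝ X y) = 0 := hdiv
    simp [h0]
  · rw [hfd]
    exact exists_holder_of_bounded_of_lipschitz hα0 hα1 hDM hL0 hL
  · rw [← dist_eq_norm]
    refine φ.dist_normed_convolution_le hX.continuous.aestronglyMeasurable fun y hy => ?_
    rw [dist_eq_norm]
    have h1 : ‖X y - X x‖ ≤ M * ‖y - x‖ := convex_univ.norm_image_sub_le_of_norm_fderiv_le
      (fun z _ => hX.differentiable one_ne_zero z) (fun z _ => hM z) (mem_univ x) (mem_univ y)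
    have h2 : ‖y - x‖ ≤ ε / (M + 1) := by
      rw [← dist_eq_norm]
      exact (mem_ball.1 hy).le.trans (min_le_right _ _)
    calc ‖X y - X x‖ ≤ M * (ε / (M + 1)) := h1.trans (by gcongr)
      _ ≤ ε := by
        rw [mul_div_assoc', div_le_iff₀ (by positivity)]
        nlinarith
  · rw [hfd]
    exact hDX x

end Mollify

section Final

variable {n : ℕ} {α : ℝ} {X Y : EuclideanSpace ℝ (Fin n) → EuclideanSpace ℝ (Fin n)}

theorem DivFree.add (hX : DivFree X) (hY : DivFree Y) (cX : ContDiff ℝ 1 X) (cY : ContDiff ℝ 1 Y) :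
    DivFree fun x => X x + Y x := fun x => by
  rw [fderiv_fun_add (cX.differentiable one_ne_zero x) (cY.differentiable one_ne_zero x),
    ContinuousLinearMap.toLinearMap_add, map_add, hX x, hY x, add_zero]

theorem DivFree.neg (hX : DivFree X) : DivFree fun x => -X x := fun x => by
  rw [fderiv_fun_neg, ContinuousLinearMap.toLinearMap_neg, map_neg, hX x, neg_zero]

theorem C1Holder.add (hX : C1Holder α X) (hY : C1Holder α Y) : C1Holder α fun x => X x + Y x := by
  obtain ⟨cX, A, hA, hXA⟩ := hX
  obtain ⟨cY, B, hB, hYB⟩ := hY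
  refine ⟨cX.add cY, A + B, add_nonneg hA hB, fun x y => ?_⟩
  rw [fderiv_fun_add (cX.differentiable one_ne_zero x) (cY.differentiable one_ne_zero x),
    fderiv_fun_add (cX.differentiable one_ne_zero y) (cY.differentiable one_ne_zero y),
    add_sub_add_comm, add_mul]
  exact norm_add_le_of_le (hXA x y) (hYB x y)

theorem C1Holder.neg (hX : C1Holder α X) : C1Holder α fun x => -X x := by
  obtain ⟨cX, A, hA, hXA⟩ := hX
  refine ⟨cX.neg, A, hA, fun x y => ?_⟩
  rw [fderiv_fun_neg, fderiv_fun_neg, ← neg_sub', norm_neg]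
  exact hXA x y

end Final

/-- The C¹ pasting lemma for divergence-free vector fields. -/
theorem pasting_lemma_C1 (n : ℕ) (hn : 2 ≤ n) (α : ℝ) (hα : α ∈ Set.Ioo (0:ℝ) 1)
    (K : Set (EuclideanSpace ℝ (Fin n))) (hK : IsCompact K)
    (U : Set (EuclideanSpace ℝ (Fin n))) (hU : IsOpen U) (hUb : Bornology.IsBounded U)
    (hKU : K ⊆ U)
    (X : EuclideanSpace ℝ (Fin n) → EuclideanSpace ℝ (Fin n))
    (hX : ContDiff ℝ 1 X) (hXdiv : DivFree X)
    (hDXbdd : ∃ M : ℝ, ∀ x, ‖fderiv ℝ X x‖ ≤ M)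
    (hDXuc : UniformContinuous (fun x => fderiv ℝ X x))
    (ε : ℝ) (hε : 0 < ε) :
    ∃ δ > (0:ℝ),
      ∀ Y : EuclideanSpace ℝ (Fin n) → EuclideanSpace ℝ (Fin n),
        C1Holder α Y → DivFree Y →
        (∀ x ∈ U, ‖X x - Y x‖ + ‖fderiv ℝ X x - fderiv ℝ Y x‖ < δ) →
        ∃ (Z : EuclideanSpace ℝ (Fin n) → EuclideanSpace ℝ (Fin n))
          (V : Set (EuclideanSpace ℝ (Fin n))),
          IsOpen V ∧ K ⊆ V ∧ V ⊆ U ∧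
          C1Holder α Z ∧ DivFree Z ∧
          (∀ x ∈ V, Z x = Y x) ∧
          (∀ x, ‖Z x - X x‖ + ‖fderiv ℝ Z x - fderiv ℝ X x‖ < ε) ∧
          (ContDiff ℝ (⊤ : ℕ∞) Y → ContDiff ℝ (⊤ : ℕ∞) Z) := by
  obtain ⟨hα0, hα1⟩ := hα
  obtain ⟨M, hM⟩ := hDXbdd
  obtain ⟨C, V, hC, hV, hKV, hVU, hcut⟩ := exists_divFree_cutoff hn hα0 hα1 hK hU hKU
  set δ : ℝ := ε / (4 * C + 3) with hδ
  have hδ0 : 0 < δ := by positivity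
  have hδε : δ * (4 * C + 3) = ε := div_mul_cancel₀ _ (by positivity)
  obtain ⟨X', hX's, hX'div, hX'h, hX'X⟩ :=
    exists_smooth_divFree_approx hα0 hα1 hX hXdiv hM hDXuc hδ0
  refine ⟨δ, hδ0, fun Y hY hYdiv hXY => ?_⟩
  have hWh := hY.add hX'h.neg
  have hfd : ∀ x, fderiv ℝ (fun x => Y x + -X' x) x = fderiv ℝ Y x - fderiv ℝ X' x := fun x => by
    simp only [← sub_eq_add_neg]
    exact fderiv_fun_sub (hY.1.differentiable one_ne_zero x) (hX'h.1.differentiable one_ne_zero x)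
  obtain ⟨Z, hZ, hZdiv, hZV, R, hZR⟩ := hcut True (ContDiff ℝ ∞ fun x => Y x + -X' x) (δ + δ)
    (fun x => Y x + -X' x) (by positivity) hWh.1 (hYdiv.add hX'div.neg hY.1 hX'h.neg.1)
    (fun x hx => by
      have h1 := hXY x hx
      obtain ⟨h2, h3⟩ := hX'X x
      have h4 := norm_nonneg (X x - Y x)
      have h5 := norm_nonneg (fderiv ℝ X x - fderiv ℝ Y x)
      rw [hfd, ← sub_eq_add_neg]
      refine ⟨(norm_sub_le_norm_sub_add_norm_sub _ (X x) _).trans ?_,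
        (norm_sub_le_norm_sub_add_norm_sub _ (fderiv ℝ X x) _).trans ?_⟩
      · rw [norm_sub_rev (Y x), norm_sub_rev (X x) (X' x)]
        linarith
      · rw [norm_sub_rev (fderiv ℝ Y x), norm_sub_rev (fderiv ℝ X x) (fderiv ℝ X' x)]
        linarith)
    (fun _ _ => let ⟨A, hA, h⟩ := hWh.2; ⟨A, hA, fun x y _ _ => h x y⟩) id
  have hZh : C1Holder α Z := ⟨hZ.contDiff, (hZ.holder trivial).global hα0
    (fderiv_eq_zero_of_norm_lt hZR) hZ.bound_fderiv⟩
  refine ⟨fun x => X' x + Z x, V, hV, hKV, hVU, hX'h.add hZh,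
    hX'div.add hZdiv hX'h.1 hZ.contDiff, fun x hx => by simp [hZV x hx], fun x => ?_, fun hYs => ?_⟩
  · obtain ⟨h1, h2⟩ := hX'X x
    have h3 := hZ.bound x
    have h4 := hZ.bound_fderiv x
    rw [fderiv_fun_add (hX'h.1.differentiable one_ne_zero x)
      (hZ.contDiff.differentiable one_ne_zero x), add_sub_right_comm, add_sub_right_comm]
    have h5 := norm_add_le (X' x - X x) (Z x)
    have h6 := norm_add_le (fderiv ℝ X' x - fderiv ℝ X x) (fderiv ℝ Z x)
    linarith
  · exact hX's.add (hZ.smooth (hYs.add hX's.neg))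
end
end

section
/- (Non-estimate theorem for the divergence equation.) Let d ≥ 2, and let Iᵈ = [0,1]ᵈ. For every r > 0 and every K > 0, there is no map 𝓛 that assigns to each C^∞ function g : ℝᵈ → ℝ with ‖g‖_{C⁰(Iᵈ)} ≤ r a C^∞ vector field 𝓛g : ℝᵈ → ℝᵈ such that both: (i) div(𝓛g)(x) = g(x) for all x ∈ Iᵈ, and (ii) ‖𝓛g₁ − 𝓛g₂‖_{C¹(Iᵈ)} ≤ K·‖g₁ − g₂‖_{C⁰(Iᵈ)} for all g₁, g₂ in the domain of 𝓛. In particular there is no Lipschitz (even nonlinear) right inverse, from the C⁰-norm to the C¹-norm, of the divergence operator on smooth functions of C⁰-norm at most r. -/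
noncomputable section

/-- The unit cube [0,1]^d. -/
def unitCube (d : ℕ) : Set (EuclideanSpace ℝ (Fin d)) :=
  {x | ∀ i, x i ∈ Set.Icc (0:ℝ) 1}

/-- C⁰ norm on the unit cube. -/
def c0Norm {d : ℕ} (g : EuclideanSpace ℝ (Fin d) → ℝ) : ℝ :=
  sSup ((fun x => |g x|) '' unitCube d)

/-- C¹ norm on the unit cube. -/
def c1Norm {d : ℕ} (v : EuclideanSpace ℝ (Fin d) → EuclideanSpace ℝ (Fin d)) : ℝ :=
  sSup ((fun x => ‖v x‖ + ‖fderiv ℝ v x‖) '' unitCube d)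

/-- Divergence of a vector field at a point: trace of the total derivative. -/
def diver {d : ℕ} (v : EuclideanSpace ℝ (Fin d) → EuclideanSpace ℝ (Fin d))
    (x : EuclideanSpace ℝ (Fin d)) : ℝ :=
  LinearMap.trace ℝ (EuclideanSpace ℝ (Fin d)) (fderiv ℝ v x).toLinearMap

open MeasureTheory Set

/-- A rectangle function `B a b c d`, thought of as the flux in the second coordinate direction
through the rectangle `[a, b] × [c, d]` of a `K`-Lipschitz function on the unit square. -/
structure IsLipschitzFlux (K : ℝ) (B : ℝ → ℝ → ℝ → ℝ → ℝ) : Prop where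
  abs_le : ∀ {a b c d : ℝ}, 0 ≤ a → a ≤ b → b ≤ 1 → 0 ≤ c → c ≤ d → d ≤ 1 →
    |B a b c d| ≤ K * ((b - a) * (d - c))
  add_fst : ∀ {a b b' c d : ℝ}, 0 ≤ a → a ≤ b → b ≤ b' → b' ≤ 1 → 0 ≤ c → c ≤ d → d ≤ 1 →
    B a b' c d = B a b c d + B b b' c d
  add_snd : ∀ {a b c d d' : ℝ}, 0 ≤ a → a ≤ b → b ≤ 1 → 0 ≤ c → c ≤ d → d ≤ d' → d' ≤ 1 →
    B a b c d' = B a b c d + B a b d d'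
  shift : ∀ {a b c d s : ℝ}, 0 ≤ a → a ≤ b → 0 ≤ s → b + s ≤ 1 → 0 ≤ c → c ≤ d → d ≤ 1 →
    |B (a + s) (b + s) c d - B a b c d| ≤ K * (s * (b - a))

namespace IsLipschitzFlux

variable {K : ℝ} {B : ℝ → ℝ → ℝ → ℝ → ℝ}

theorem neg (hB : IsLipschitzFlux K B) : IsLipschitzFlux K (fun a b c d => -B a b c d) where
  abs_le h1 h2 h3 h4 h5 h6 := by rw [abs_neg]; exact hB.abs_le h1 h2 h3 h4 h5 h6
  add_fst h1 h2 h3 h4 h5 h6 h7 := by rw [hB.add_fst h1 h2 h3 h4 h5 h6 h7]; ring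
  add_snd h1 h2 h3 h4 h5 h6 h7 := by rw [hB.add_snd h1 h2 h3 h4 h5 h6 h7]; ring
  shift h1 h2 h3 h4 h5 h6 h7 := by
    rw [neg_sub_neg, abs_sub_comm]; exact hB.shift h1 h2 h3 h4 h5 h6 h7

theorem sum {ι : Type*} [Fintype ι] {F : ι → ℝ → ℝ → ℝ → ℝ → ℝ} {w : ι → ℝ} (hK : 0 ≤ K)
    (hw : ∀ k, |w k| ≤ 1) (hF : ∀ k, w k ≠ 0 → IsLipschitzFlux K (F k)) :
    IsLipschitzFlux (Fintype.card ι * K) (fun a b c d => ∑ k, w k * F k a b c d) where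
  abs_le {a b c d} h1 h2 h3 h4 h5 h6 := by
    have hnn : 0 ≤ K * ((b - a) * (d - c)) :=
      mul_nonneg hK (mul_nonneg (sub_nonneg.2 h2) (sub_nonneg.2 h5))
    refine (Finset.abs_sum_le_sum_abs _ _).trans ?_
    refine (Finset.sum_le_card_nsmul _ _ (K * ((b - a) * (d - c))) fun k _ => ?_).trans_eq ?_
    · rcases eq_or_ne (w k) 0 with h | h
      · simpa [h] using hnn
      · rw [abs_mul]
        exact (mul_le_of_le_one_left (abs_nonneg _) (hw k)).trans
          ((hF k h).abs_le h1 h2 h3 h4 h5 h6)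
    · simp [mul_assoc]
  add_fst h1 h2 h3 h4 h5 h6 h7 := by
    rw [← Finset.sum_add_distrib]
    refine Finset.sum_congr rfl fun k _ => ?_
    rcases eq_or_ne (w k) 0 with h | h
    · simp [h]
    · rw [(hF k h).add_fst h1 h2 h3 h4 h5 h6 h7, mul_add]
  add_snd h1 h2 h3 h4 h5 h6 h7 := by
    rw [← Finset.sum_add_distrib]
    refine Finset.sum_congr rfl fun k _ => ?_
    rcases eq_or_ne (w k) 0 with h | h
    · simp [h]
    · rw [(hF k h).add_snd h1 h2 h3 h4 h5 h6 h7, mul_add]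
  shift {a b c d s} h1 h2 h3 h4 h5 h6 h7 := by
    have hnn : 0 ≤ K * (s * (b - a)) := mul_nonneg hK (mul_nonneg h3 (sub_nonneg.2 h2))
    rw [← Finset.sum_sub_distrib]
    refine (Finset.abs_sum_le_sum_abs _ _).trans ?_
    refine (Finset.sum_le_card_nsmul _ _ (K * (s * (b - a))) fun k _ => ?_).trans_eq ?_
    · rcases eq_or_ne (w k) 0 with h | h
      · simpa [h] using hnn
      · rw [← mul_sub, abs_mul]
        exact (mul_le_of_le_one_left (abs_nonneg _) (hw k)).trans
          ((hF k h).shift h1 h2 h3 h4 h5 h6 h7)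
    · simp [mul_assoc]

theorem eq_sum_fst (hB : IsLipschitzFlux K B) {x h c d : ℝ} (hx : 0 ≤ x) (hh : 0 ≤ h)
    (hc : 0 ≤ c) (hcd : c ≤ d) (hd : d ≤ 1) (n : ℕ) (hn : x + n * h ≤ 1) :
    B x (x + n * h) c d = ∑ k ∈ Finset.range n, B (x + k * h) (x + k * h + h) c d := by
  induction n with
  | zero => simpa using hB.add_fst hx le_rfl le_rfl (by simpa using hn) hc hcd hd
  | succ n ih =>
    push_cast at hn ⊢
    have hnh : 0 ≤ n * h := by positivity
    rw [Finset.sum_range_succ, ← ih (by linarith), add_one_mul, ← add_assoc,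
      hB.add_fst (b := x + n * h) hx (by linarith) (by linarith) (by linarith) hc hcd hd]

theorem eq_sum_snd (hB : IsLipschitzFlux K B) {y h a b : ℝ} (hy : 0 ≤ y) (hh : 0 ≤ h)
    (ha : 0 ≤ a) (hab : a ≤ b) (hb : b ≤ 1) (n : ℕ) (hn : y + n * h ≤ 1) :
    B a b y (y + n * h) = ∑ k ∈ Finset.range n, B a b (y + k * h) (y + k * h + h) := by
  induction n with
  | zero => simpa using hB.add_snd ha hab hb hy le_rfl le_rfl (by simpa using hn)
  | succ n ih =>
    push_cast at hn ⊢
    have hnh : 0 ≤ n * h := by positivity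
    rw [Finset.sum_range_succ, ← ih (by linarith), add_one_mul, ← add_assoc,
      hB.add_snd (d := y + n * h) ha hab hb hy (by linarith) (by linarith) (by linarith)]

/-- If the flux is at most `M h²` through the cells of side `h = l / (2 n)` filling the right halves
of `n` equal vertical strips of a square of side `l`, then the flux through the whole square is at
most `(M + K / (4 n)) l²`. -/
theorem le_of_le_cells (hB : IsLipschitzFlux K B) {x y h M : ℝ} (n : ℕ)
    (hx : 0 ≤ x) (hy : 0 ≤ y) (hh : 0 ≤ h) (hx1 : x + 2 * n * h ≤ 1) (hy1 : y + 2 * n * h ≤ 1)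
    (hM : ∀ k < n, ∀ j < 2 * n,
      B (x + k * (2 * h) + h) (x + k * (2 * h) + h + h) (y + j * h) (y + j * h + h) ≤ M * h ^ 2) :
    B x (x + 2 * n * h) y (y + 2 * n * h) ≤ (4 * n ^ 2 * M + n * K) * h ^ 2 := by
  have hnh : 0 ≤ 2 * n * h := by positivity
  have hstrip : ∀ k ∈ Finset.range n,
      B (x + k * (2 * h)) (x + k * (2 * h) + 2 * h) y (y + 2 * n * h)
        ≤ (4 * n * M + K) * h ^ 2 := by
    intro k hk
    have hk : k < n := Finset.mem_range.1 hk
    have hk' : (k : ℝ) + 1 ≤ n := by exact_mod_cast hk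
    have hkh : (k + 1) * (2 * h) ≤ n * (2 * h) := by gcongr
    have hk0 : 0 ≤ k * (2 * h) := by positivity
    have hright : B (x + k * (2 * h) + h) (x + k * (2 * h) + h + h) y (y + 2 * n * h)
        ≤ 2 * n * M * h ^ 2 := by
      have := hB.eq_sum_snd hy hh (a := x + k * (2 * h) + h) (b := x + k * (2 * h) + h + h)
        (by linarith) (by linarith) (by linarith) (2 * n) (by push_cast; linarith)
      push_cast at this
      rw [this]
      refine (Finset.sum_le_card_nsmul _ _ (M * h ^ 2) fun j hj =>
        hM k hk j (Finset.mem_range.1 hj)).trans_eq ?_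
      simp; ring
    have hshift := (_root_.abs_le.1
      (hB.shift (a := x + k * (2 * h)) (b := x + k * (2 * h) + h) (s := h)
      (c := y) (d := y + 2 * n * h) (by linarith) (by linarith) hh (by linarith) hy (by linarith)
      hy1)).1
    have hadd := hB.add_fst (a := x + k * (2 * h)) (b := x + k * (2 * h) + h)
      (b' := x + k * (2 * h) + 2 * h) (c := y) (d := y + 2 * n * h) (by linarith) (by linarith)
      (by linarith) (by linarith) hy (by linarith) hy1
    have he : x + k * (2 * h) + 2 * h = x + k * (2 * h) + h + h := by ring
    rw [hadd, he]
    linarith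
  have hsum := hB.eq_sum_fst hx (h := 2 * h) (by linarith) hy (by linarith) hy1 n (by linarith)
  have he : x + 2 * n * h = x + n * (2 * h) := by ring
  rw [he, hsum]
  refine (Finset.sum_le_card_nsmul _ _ _ hstrip).trans_eq ?_
  simp; ring

end IsLipschitzFlux

/-- A smooth `1`-periodic cutoff vanishing on `[1/2, 1]` and close to `1` on `[0, 1/2]`. -/
def stripCutoff (t : ℝ) : ℝ := Real.smoothTransition (5 * Real.sin (2 * Real.pi * t))

theorem contDiff_stripCutoff : ContDiff ℝ (⊤ : ℕ∞) stripCutoff :=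
  Real.smoothTransition.contDiff.comp (by fun_prop)

theorem stripCutoff_nonneg (t : ℝ) : 0 ≤ stripCutoff t := Real.smoothTransition.nonneg _

theorem stripCutoff_le_one (t : ℝ) : stripCutoff t ≤ 1 := Real.smoothTransition.le_one _

theorem periodic_stripCutoff : Function.Periodic stripCutoff 1 := by
  intro t
  simp [stripCutoff, mul_add, Real.sin_add_two_pi]

theorem stripCutoff_eq_zero {t : ℝ} (h : t ∈ Icc (1 / 2 : ℝ) 1) : stripCutoff t = 0 := by
  have hs : 0 ≤ Real.sin (2 * Real.pi * t - Real.pi) :=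
    Real.sin_nonneg_of_nonneg_of_le_pi (by nlinarith [Real.pi_pos, h.1])
      (by nlinarith [Real.pi_pos, h.2])
  rw [Real.sin_sub_pi] at hs
  exact Real.smoothTransition.zero_of_nonpos (by linarith)

theorem stripCutoff_eq_one {t : ℝ} (h : t ∈ Icc (1 / 20 : ℝ) (9 / 20)) : stripCutoff t = 1 := by
  have hpi := Real.pi_pos
  have key : ∀ u : ℝ, 1 / 20 ≤ u → u ≤ 1 / 4 → 1 / 5 ≤ Real.sin (2 * Real.pi * u) := by
    intro u h1 h2
    refine le_trans ?_ (Real.mul_le_sin (by positivity) (by nlinarith))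
    field_simp
    linarith
  refine Real.smoothTransition.one_of_one_le ?_
  rcases le_total t (1 / 4) with h' | h'
  · linarith [key t h.1 h']
  · have := key (1 / 2 - t) (by linarith [h.2]) (by linarith)
    rw [show 2 * Real.pi * (1 / 2 - t) = Real.pi - 2 * Real.pi * t by ring, Real.sin_pi_sub] at this
    linarith

theorem le_integral_stripCutoff : 2 / 5 ≤ ∫ t in (0 : ℝ)..(1 / 2), stripCutoff t := by
  have h1 : ∫ t in (1 / 20 : ℝ)..(9 / 20), stripCutoff t = 2 / 5 := by
    rw [intervalIntegral.integral_congr (g := fun _ => (1 : ℝ))]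
    · norm_num
    · intro t ht
      rw [uIcc_of_le (by norm_num)] at ht
      exact stripCutoff_eq_one ht
  rw [← h1]
  refine intervalIntegral.integral_mono_interval (by norm_num) (by norm_num) (by norm_num)
    (Filter.Eventually.of_forall stripCutoff_nonneg)
    (contDiff_stripCutoff.continuous.intervalIntegrable _ _)

/-- Strips of frequency `n` in the first variable, alternating between the value `1` and rescaled
copies of the negated transpose of `g`. -/
def laminate (n : ℕ) (g : ℝ → ℝ → ℝ) (s t : ℝ) : ℝ :=
  stripCutoff (n * s) - (1 - stripCutoff (n * s)) * g (2 * n * t) (2 * n * s)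

/-- Smooth functions on the plane, `1`-periodic in both variables and bounded by `1`. -/
structure IsPattern (g : ℝ → ℝ → ℝ) : Prop where
  contDiff : ContDiff ℝ (⊤ : ℕ∞) (fun p : ℝ × ℝ => g p.1 p.2)
  periodic_fst : ∀ t, Function.Periodic (fun s => g s t) 1
  periodic_snd : ∀ s, Function.Periodic (g s) 1
  abs_le_one : ∀ s t, |g s t| ≤ 1

theorem IsPattern.laminate {g : ℝ → ℝ → ℝ} (hg : IsPattern g) (n : ℕ) :
    IsPattern (laminate n g) where
  contDiff := by
    have h1 : ContDiff ℝ (⊤ : ℕ∞) (fun p : ℝ × ℝ => stripCutoff (n * p.1)) :=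
      contDiff_stripCutoff.comp (by fun_prop)
    have h2 : ContDiff ℝ (⊤ : ℕ∞) (fun p : ℝ × ℝ => g (2 * n * p.2) (2 * n * p.1)) :=
      hg.contDiff.comp (f := fun p : ℝ × ℝ => (2 * n * p.2, 2 * n * p.1)) (by fun_prop)
    exact h1.sub ((contDiff_const.sub h1).mul h2)
  periodic_fst t s := by
    have h1 := periodic_stripCutoff.nat_mul n (n * s)
    have h2 := (hg.periodic_snd (2 * n * t)).nat_mul (2 * n) (2 * n * s)
    push_cast [mul_one] at h1 h2
    simp only [_root_.laminate, mul_add, mul_one, h1, h2]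
  periodic_snd s t := by
    have h2 := (hg.periodic_fst (2 * n * s)).nat_mul (2 * n) (2 * n * t)
    push_cast [mul_one] at h2
    simp only [_root_.laminate, mul_add, mul_one, h2]
  abs_le_one s t := by
    have h0 := stripCutoff_nonneg (n * s)
    have h1 := stripCutoff_le_one (n * s)
    have h2 := abs_le.1 (hg.abs_le_one (2 * n * t) (2 * n * s))
    rw [_root_.laminate, abs_le]
    constructor <;> nlinarith

theorem Function.Periodic.integral_comp_nat_mul {f : ℝ → ℝ} (hf : Function.Periodic f 1)
    (hc : Continuous f) {n : ℕ} (hn : n ≠ 0) :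
    ∫ t in (0 : ℝ)..1, f (n * t) = ∫ t in (0 : ℝ)..1, f t := by
  have hn' : (n : ℝ) ≠ 0 := Nat.cast_ne_zero.2 hn
  have := hf.intervalIntegral_add_zsmul_eq n 0 fun _ _ => hc.intervalIntegrable _ _
  rw [intervalIntegral.integral_comp_mul_left _ hn']
  simp only [zero_add, zsmul_eq_mul, Int.cast_natCast, mul_one] at this
  rw [mul_zero, mul_one, this, smul_eq_mul, inv_mul_cancel_left₀ hn']

theorem intervalIntegral_swap_of_continuous {g : ℝ → ℝ → ℝ}
    (hg : Continuous (fun p : ℝ × ℝ => g p.1 p.2)) (a b c d : ℝ) :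
    ∫ s in a..b, ∫ t in c..d, g s t = ∫ t in c..d, ∫ s in a..b, g s t := by
  refine intervalIntegral_intervalIntegral_swap ?_
  refine IntegrableOn.mono_set (t := uIcc a b ×ˢ uIcc c d) ?_
    (prod_mono uIoc_subset_uIcc uIoc_subset_uIcc)
  exact hg.continuousOn.integrableOn_compact (isCompact_uIcc.prod isCompact_uIcc)

theorem IsPattern.integral_laminate_mem {g : ℝ → ℝ → ℝ} (hg : IsPattern g) {n : ℕ} (hn : n ≠ 0)
    (hD : ∫ s in (0 : ℝ)..1, ∫ t in (0 : ℝ)..1, g s t ∈ Icc (1 / 20 : ℝ) (1 / 2)) :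
    ∫ s in (0 : ℝ)..1, ∫ t in (0 : ℝ)..1, _root_.laminate n g s t ∈ Icc (1 / 20 : ℝ) (1 / 2) := by
  have hgc := hg.contDiff.continuous
  have hχc := contDiff_stripCutoff.continuous
  set D := ∫ s in (0 : ℝ)..1, ∫ t in (0 : ℝ)..1, g s t with hDdef
  set G : ℝ → ℝ := fun σ => ∫ τ in (0 : ℝ)..1, g τ σ with hG
  have hGc : Continuous G := by
    refine intervalIntegral.continuous_parametric_intervalIntegral_of_continuous' ?_ 0 1
    exact hgc.comp (continuous_snd.prodMk continuous_fst)
  have hGp : Function.Periodic G 1 := fun σ => by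
    simp only [hG]
    exact intervalIntegral.integral_congr fun τ _ => hg.periodic_snd τ σ
  have hGD : ∫ σ in (0 : ℝ)..1, G σ = D :=
    (intervalIntegral_swap_of_continuous hgc 0 1 0 1).symm
  have hG1 : ∀ σ, |G σ| ≤ 1 := fun σ => by
    have := intervalIntegral.norm_integral_le_of_norm_le_const (a := 0) (b := 1)
      (f := fun τ => g τ σ) (C := 1) fun τ _ => hg.abs_le_one τ σ
    simpa using this
  set H : ℝ → ℝ := fun σ => stripCutoff σ - (1 - stripCutoff σ) * G (2 * σ) with hH
  have hHc : Continuous H := by fun_prop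
  have hHp : Function.Periodic H 1 := fun σ => by
    have h2 := hGp.nat_mul 2 (2 * σ)
    push_cast [mul_one] at h2
    simp only [hH, mul_add, mul_one, h2, periodic_stripCutoff σ]
  have hinner : ∀ s, ∫ t in (0 : ℝ)..1, _root_.laminate n g s t = H (n * s) := by
    intro s
    have hc : Continuous fun τ => g τ (2 * n * s) :=
      hgc.comp (continuous_id.prodMk continuous_const)
    have h2 := (hg.periodic_fst (2 * n * s)).integral_comp_nat_mul hc
      (n := 2 * n) (by positivity)
    push_cast at h2
    simp only [_root_.laminate]
    have hi : IntervalIntegrable (fun t => (1 - stripCutoff (n * s)) * g (2 * n * t) (2 * n * s))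
        volume 0 1 :=
      (continuous_const.mul (hc.comp (continuous_const_mul (2 * n : ℝ)))).intervalIntegrable _ _
    rw [intervalIntegral.integral_sub intervalIntegrable_const hi,
      intervalIntegral.integral_const_mul, h2]
    simp [hH, hG, mul_assoc]
  have htot : ∫ s in (0 : ℝ)..1, ∫ t in (0 : ℝ)..1, _root_.laminate n g s t
      = ∫ σ in (0 : ℝ)..1, H σ := by
    simp only [hinner]
    exact hHp.integral_comp_nat_mul hHc hn
  have hright : ∫ σ in (1 / 2 : ℝ)..1, H σ = -(D / 2) := by
    have : ∫ σ in (1 / 2 : ℝ)..1, H σ = ∫ σ in (1 / 2 : ℝ)..1, -G (2 * σ) := by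
      refine intervalIntegral.integral_congr fun σ hσ => ?_
      rw [uIcc_of_le (by norm_num)] at hσ
      simp [hH, stripCutoff_eq_zero hσ]
    rw [this, intervalIntegral.integral_neg, intervalIntegral.integral_comp_mul_left _ two_ne_zero]
    have h3 := hGp.intervalIntegral_add_eq 1 0
    rw [zero_add, hGD] at h3
    norm_num at h3 ⊢
    rw [h3]; ring
  have hsplit := intervalIntegral.integral_add_adjacent_intervals
    (hHc.intervalIntegrable (μ := volume) 0 (1 / 2)) (hHc.intervalIntegrable (1 / 2) 1)
  have hupper : ∫ σ in (0 : ℝ)..(1 / 2), H σ ≤ 1 / 2 := by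
    have := intervalIntegral.integral_mono_on (f := H) (g := fun _ => (1 : ℝ)) (a := 0) (b := 1 / 2)
      (μ := volume) (by norm_num) (hHc.intervalIntegrable _ _) (by simp) fun σ _ => by
        have h0 := stripCutoff_nonneg σ
        have h1 := stripCutoff_le_one σ
        have h2 := abs_le.1 (hG1 (2 * σ))
        simp only [hH]
        nlinarith
    simpa using this
  have hlower : 3 / 10 ≤ ∫ σ in (0 : ℝ)..(1 / 2), H σ := by
    have := intervalIntegral.integral_mono_on (f := fun σ => 2 * stripCutoff σ - 1) (g := H)
      (a := 0) (b := 1 / 2) (μ := volume) (by norm_num)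
      (Continuous.intervalIntegrable (by fun_prop) _ _) (hHc.intervalIntegrable _ _) fun σ _ => by
        have h0 := stripCutoff_nonneg σ
        have h1 := stripCutoff_le_one σ
        have h2 := abs_le.1 (hG1 (2 * σ))
        simp only [hH]
        nlinarith
    refine le_trans ?_ this
    rw [intervalIntegral.integral_sub (Continuous.intervalIntegrable (by fun_prop) _ _) (by simp),
      intervalIntegral.integral_const_mul]
    have := le_integral_stripCutoff
    simp
    linarith
  rw [htot, ← hsplit, hright]
  exact ⟨by linarith [hD.2], by linarith [hD.1]⟩

theorem integral_integral_rescale (g : ℝ → ℝ → ℝ) (x y : ℝ) {l : ℝ} (hl : l ≠ 0) :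
    ∫ u in x..x + l, ∫ w in y..y + l, g ((u - x) / l) ((w - y) / l)
      = l ^ 2 * ∫ s in (0 : ℝ)..1, ∫ t in (0 : ℝ)..1, g s t := by
  have key : ∀ (f : ℝ → ℝ) (z : ℝ), ∫ w in z..z + l, f ((w - z) / l) = l * ∫ t in (0 : ℝ)..1, f t := by
    intro f z
    rw [intervalIntegral.integral_comp_sub_right (fun w => f (w / l)) z,
      intervalIntegral.integral_comp_div _ hl]
    simp [hl]
  simp only [key]
  rw [key (fun s => l * ∫ t in (0 : ℝ)..1, g s t), intervalIntegral.integral_const_mul]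
  ring

theorem IsPattern.laminate_cell {g : ℝ → ℝ → ℝ} (hg : IsPattern g) {n : ℕ} (hn : n ≠ 0) (k j : ℕ)
    (x y : ℝ) {h : ℝ} (hh : 0 < h) {u w : ℝ} (hu : u ∈ Icc (x + k * (2 * h) + h) (x + k * (2 * h) + h + h)) :
    _root_.laminate n g ((u - x) / (2 * n * h)) ((w - y) / (2 * n * h))
      = -g ((w - (y + j * h)) / h) ((u - (x + k * (2 * h) + h)) / h) := by
  have hn' : (n : ℝ) ≠ 0 := Nat.cast_ne_zero.2 hn
  have e1 : n * ((u - x) / (2 * n * h)) = ((u - (x + k * (2 * h) + h)) / h + 1) / 2 + k * 1 := by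
    field_simp; ring
  have e2 : 2 * n * ((u - x) / (2 * n * h))
      = (u - (x + k * (2 * h) + h)) / h + ((2 * k + 1 : ℕ) : ℝ) * 1 := by
    push_cast; field_simp; ring
  have e3 : 2 * n * ((w - y) / (2 * n * h)) = (w - (y + j * h)) / h + (j : ℝ) * 1 := by
    field_simp; ring
  have h0 : 0 ≤ (u - (x + k * (2 * h) + h)) / h := div_nonneg (by linarith [hu.1]) hh.le
  have h1 : (u - (x + k * (2 * h) + h)) / h ≤ 1 := (div_le_one hh).2 (by linarith [hu.2])
  have hχ : stripCutoff (n * ((u - x) / (2 * n * h))) = 0 := by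
    rw [e1, periodic_stripCutoff.nat_mul k]
    exact stripCutoff_eq_zero ⟨by linarith, by linarith⟩
  rw [_root_.laminate, hχ, e2, e3, hg.periodic_snd _ |>.nat_mul (2 * k + 1)]
  have := (hg.periodic_fst ((u - (x + k * (2 * h) + h)) / h)).nat_mul j ((w - (y + j * h)) / h)
  beta_reduce at this
  rw [this]; ring

/-- For each `m` there is a pattern `g` such that, whenever two `K`-Lipschitz fluxes add up to the
integral of a copy of `g` scaled to a square of side `l`, the second one is at most
`(K - m / 40) l²` on that square. -/
theorem exists_pattern_flux_le {K : ℝ} (hK : 0 ≤ K) (m : ℕ) :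
    ∃ g : ℝ → ℝ → ℝ, IsPattern g ∧
      ∫ s in (0 : ℝ)..1, ∫ t in (0 : ℝ)..1, g s t ∈ Icc (1 / 20 : ℝ) (1 / 2) ∧
      ∀ A B, IsLipschitzFlux K A → IsLipschitzFlux K B → ∀ x y l : ℝ, 0 ≤ x → 0 ≤ y → 0 < l →
        x + l ≤ 1 → y + l ≤ 1 →
        (∀ a b c d, x ≤ a → a ≤ b → b ≤ x + l → y ≤ c → c ≤ d → d ≤ y + l →
          A c d a b + B a b c d = ∫ u in a..b, ∫ w in c..d, g ((u - x) / l) ((w - y) / l)) →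
        B x (x + l) y (y + l) ≤ (K - m / 40) * l ^ 2 := by
  induction m with
  | zero =>
    refine ⟨fun _ _ => 1 / 2, ⟨contDiff_const, fun _ _ => rfl, fun _ _ => rfl, fun _ _ => ?_⟩, ?_, ?_⟩
    · norm_num [abs_le]
    · norm_num
    · intro A B _ hB x y l hx hy hl hx1 hy1 _
      refine (le_abs_self _).trans ((hB.abs_le hx (by linarith) hx1 hy (by linarith) hy1).trans_eq ?_)
      push_cast; ring
  | succ m ih =>
    obtain ⟨g, hg, hD, hgB⟩ := ih
    obtain ⟨n, hn⟩ := exists_nat_gt (10 * K)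
    have hn0 : (0 : ℝ) < n := lt_of_le_of_lt (by positivity) hn
    have hn' : n ≠ 0 := by rintro rfl; simp at hn0
    refine ⟨laminate n g, hg.laminate n, hg.integral_laminate_mem hn' hD, ?_⟩
    intro A B hA hB x y l hx hy hl hx1 hy1 hAB
    obtain ⟨h, hlh⟩ : ∃ h, l = 2 * n * h := ⟨l / (2 * n), by field_simp⟩
    have hh : 0 < h := by
      rw [hlh] at hl
      exact pos_of_mul_pos_right hl (by positivity)
    subst hlh
    set D := ∫ s in (0 : ℝ)..1, ∫ t in (0 : ℝ)..1, g s t with hDdef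
    have hcells : ∀ k < n, ∀ j < 2 * n,
        B (x + k * (2 * h) + h) (x + k * (2 * h) + h + h) (y + j * h) (y + j * h + h)
          ≤ (K - m / 40 - D) * h ^ 2 := by
      intro k hk j hj
      have hk' : (k : ℝ) + 1 ≤ n := by exact_mod_cast hk
      have hkh : (k + 1) * (2 * h) ≤ n * (2 * h) := by gcongr
      have hk0 : 0 ≤ k * (2 * h) := by positivity
      have hj' : (j : ℝ) + 1 ≤ 2 * n := by exact_mod_cast hj
      have hjh : (j + 1) * h ≤ 2 * n * h := by gcongr
      have hj0 : 0 ≤ j * h := by positivity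
      set xk := x + k * (2 * h) + h with hxk
      set yj := y + j * h with hyj
      have hcell : ∀ a b c d, yj ≤ a → a ≤ b → b ≤ yj + h → xk ≤ c → c ≤ d → d ≤ xk + h →
          -B c d a b + -A a b c d = ∫ u in a..b, ∫ w in c..d, g ((u - yj) / h) ((w - xk) / h) := by
        intro a b c d h1 h2 h3 h4 h5 h6
        have := hAB c d a b (by linarith) h5 (by linarith) (by linarith) h2 (by linarith)
        rw [← neg_add, add_comm, this, ← intervalIntegral.integral_neg,
          intervalIntegral_swap_of_continuous (g := fun u w => g ((u - yj) / h) ((w - xk) / h))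
            (hg.contDiff.continuous.comp
              (f := fun p : ℝ × ℝ => ((p.1 - yj) / h, (p.2 - xk) / h)) (by fun_prop))]
        refine intervalIntegral.integral_congr fun u hu => ?_
        rw [uIcc_of_le h5] at hu
        rw [← intervalIntegral.integral_neg]
        refine intervalIntegral.integral_congr fun w _ => ?_
        rw [hg.laminate_cell hn' k j x y hh ⟨h4.trans hu.1, hu.2.trans h6⟩, neg_neg]
      have hle := hgB _ _ hB.neg hA.neg yj xk h (by linarith) (by linarith) hh (by linarith)
        (by linarith) hcell
      have heq := hcell yj (yj + h) xk (xk + h) le_rfl (by linarith) le_rfl le_rfl (by linarith) le_rfl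
      rw [integral_integral_rescale g _ _ hh.ne', ← hDdef] at heq
      linarith
    refine (hB.le_of_le_cells n hx hy hh.le hx1 hy1 hcells).trans ?_
    have hnK : n * K ≤ n * (n / 10) := by gcongr; linarith
    have : 4 * (n : ℝ) ^ 2 * (K - m / 40 - D) + n * K ≤ 4 * n ^ 2 * (K - (m + 1) / 40) := by
      nlinarith [mul_nonneg (sq_nonneg (n : ℝ)) (sub_nonneg.2 hD.1)]
    push_cast
    calc _ ≤ 4 * (n : ℝ) ^ 2 * (K - (m + 1) / 40) * h ^ 2 := by gcongr
      _ = _ := by ring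

theorem abs_integral_partialDeriv_le {n : ℕ} {F : (Fin (n + 1) → ℝ) → ℝ} (hF : ContDiff ℝ 1 F)
    {a b : Fin (n + 1) → ℝ} (hab : a ≤ b) {C : ℝ} (hC : ∀ p ∈ Icc a b, |F p| ≤ C)
    (k : Fin (n + 1)) :
    |∫ p in Icc a b, fderiv ℝ F p (Pi.single k 1)|
      ≤ 2 * C * ∏ l, (b (k.succAbove l) - a (k.succAbove l)) := by
  have hdiff : Differentiable ℝ F := hF.differentiable one_ne_zero
  have hFc : Continuous F := hF.continuous
  have hcont : Continuous fun p => fderiv ℝ F p (Pi.single k 1) :=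
    (hF.continuous_fderiv one_ne_zero).clm_apply continuous_const
  have hsum : ∀ p, ∑ i, (if i = k then fderiv ℝ F p else 0) (Pi.single i 1)
      = fderiv ℝ F p (Pi.single k 1) := by
    intro p
    rw [Finset.sum_eq_single k] <;> simp +contextual
  have hdiv := integral_divergence_of_hasFDerivAt_off_countable' a b hab
    (fun i p => if i = k then F p else 0) (fun i p => if i = k then fderiv ℝ F p else 0) ∅
    countable_empty (fun i => by split_ifs <;> fun_prop)
    (fun p _ i => by
      split_ifs
      · exact (hdiff p).hasFDerivAt
      · exact hasFDerivAt_const _ _)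
    (by
      simp only [hsum]
      exact hcont.continuousOn.integrableOn_compact isCompact_Icc)
  simp only [hsum] at hdiv
  rw [hdiv, Finset.sum_eq_single k (by simp +contextual) (by simp)]
  simp only [if_true]
  have hab' : a ∘ k.succAbove ≤ b ∘ k.succAbove := fun l => hab _
  have hface : ∀ t ∈ Icc (a k) (b k),
      |∫ x in Icc (a ∘ k.succAbove) (b ∘ k.succAbove), F (k.insertNth t x)|
        ≤ C * ∏ l, (b (k.succAbove l) - a (k.succAbove l)) := by
    intro t ht
    have := norm_setIntegral_le_of_norm_le_const (μ := volume) (C := C)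
      (s := Icc (a ∘ k.succAbove) (b ∘ k.succAbove)) (f := fun x => F (k.insertNth t x))
      isCompact_Icc.measure_lt_top fun x hx => hC _ (by
        rw [Fin.insertNth_mem_Icc]
        exact ⟨ht, hx⟩)
    rwa [measureReal_def, Real.volume_Icc_pi_toReal hab'] at this
  have h1 := abs_le.1 (hface (b k) ⟨hab k, le_rfl⟩)
  have h2 := abs_le.1 (hface (a k) ⟨le_rfl, hab k⟩)
  rw [abs_le]
  constructor <;> linarith [h1.1, h1.2, h2.1, h2.2]

/-- The point with `i`-th coordinate `a`, `j`-th coordinate `c` and all others equal to `e`. -/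
def corner {n : ℕ} (i j : Fin n) (a c e : ℝ) (k : Fin n) : ℝ :=
  if k = i then a else if k = j then c else e

/-- The product of `[a, b]` in coordinate `i`, `[c, d]` in coordinate `j` and `[0, 1]` in all
others, without its lower faces. -/
def slabBox {n : ℕ} (i j : Fin n) (a b c d : ℝ) : Set (Fin n → ℝ) :=
  univ.pi fun k => Ioc (corner i j a c 0 k) (corner i j b d 1 k)

theorem slabBox_swap {n : ℕ} {i j : Fin n} (hij : i ≠ j) (a b c d : ℝ) :
    slabBox i j a b c d = slabBox j i c d a b := by
  unfold slabBox
  congr! 3 with k <;> unfold corner <;> split_ifs <;> simp_all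

theorem measurableSet_slabBox {n : ℕ} (i j : Fin n) (a b c d : ℝ) :
    MeasurableSet (slabBox i j a b c d) :=
  MeasurableSet.univ_pi fun _ => measurableSet_Ioc

theorem corner_le_corner {n : ℕ} (i j : Fin n) {a b c d : ℝ} (hab : a ≤ b) (hcd : c ≤ d) :
    corner i j a c 0 ≤ corner i j b d 1 := by
  intro k
  unfold corner
  split_ifs <;> simp [*]

theorem Icc_corner_subset {n : ℕ} (i j : Fin n) {a b c d : ℝ} (ha : 0 ≤ a) (hb : b ≤ 1)
    (hc : 0 ≤ c) (hd : d ≤ 1) : Icc (corner i j a c 0) (corner i j b d 1) ⊆ Icc 0 1 := by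
  refine Icc_subset_Icc (fun k => ?_) fun k => ?_ <;>
  · unfold corner
    split_ifs <;> simp [*]

theorem slabBox_ae_eq_Icc {n : ℕ} (i j : Fin n) (a b c d : ℝ) :
    slabBox i j a b c d =ᵐ[volume] Icc (corner i j a c 0) (corner i j b d 1) :=
  Measure.univ_pi_Ioc_ae_eq_Icc

theorem slabBox_subset_Icc {n : ℕ} (i j : Fin n) (a b c d : ℝ) :
    slabBox i j a b c d ⊆ Icc (corner i j a c 0) (corner i j b d 1) := fun _ hp =>
  ⟨fun k => (hp k trivial).1.le, fun k => (hp k trivial).2⟩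

theorem prod_corner {n : ℕ} {i j : Fin n} (hij : i ≠ j) (a b c d : ℝ) :
    ∏ k, (corner i j b d 1 k - corner i j a c 0 k) = (b - a) * (d - c) := by
  have : ∀ k, corner i j b d 1 k - corner i j a c 0 k
      = (if k = i then b - a else 1) * (if k = j then d - c else 1) := by
    intro k
    unfold corner
    split_ifs <;> simp_all
  simp only [this, Finset.prod_mul_distrib]
  simp

theorem slabBox_union_fst {n : ℕ} {i j : Fin n} {a b b' c d : ℝ} (hab : a ≤ b) (hbb : b ≤ b') :
    slabBox i j a b' c d = slabBox i j a b c d ∪ slabBox i j b b' c d := by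
  ext p
  simp only [slabBox, mem_union, mem_univ_pi]
  constructor
  · intro h
    rcases le_or_gt (p i) b with hp | hp
    · left
      intro k
      have := h k
      unfold corner at this ⊢
      split_ifs with h1 <;> simp_all
    · right
      intro k
      have := h k
      unfold corner at this ⊢
      split_ifs with h1 <;> simp_all
  · rintro (h | h) k <;>
    · have := h k
      unfold corner at this ⊢
      split_ifs with h1 h2 <;> grind

theorem disjoint_slabBox_fst {n : ℕ} {i j : Fin n} {a b b' c d : ℝ} :
    Disjoint (slabBox i j a b c d) (slabBox i j b b' c d) := by
  rw [Set.disjoint_left]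
  intro p hp hp'
  have h1 := (hp i trivial).2
  have h2 := (hp' i trivial).1
  simp only [corner, if_true] at h1 h2
  exact absurd h1 h2.not_ge

theorem setIntegral_slabBox_add {n : ℕ} {i j : Fin n} {φ : (Fin n → ℝ) → ℝ} (hφ : Continuous φ)
    {a b b' c d : ℝ} (hab : a ≤ b) (hbb : b ≤ b') :
    ∫ p in slabBox i j a b' c d, φ p
      = (∫ p in slabBox i j a b c d, φ p) + ∫ p in slabBox i j b b' c d, φ p := by
  have hi : ∀ a b c d, IntegrableOn φ (slabBox i j a b c d) := fun a b c d =>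
    (hφ.continuousOn.integrableOn_compact isCompact_Icc).mono_set (slabBox_subset_Icc i j a b c d)
  rw [slabBox_union_fst hab hbb, setIntegral_union disjoint_slabBox_fst
    (measurableSet_slabBox ..) (hi ..) (hi ..)]

theorem abs_integral_partialDeriv_shift_le {n : ℕ} {f : (Fin (n + 1) → ℝ) → ℝ}
    (hf : ContDiff ℝ 1 f) {M : ℝ} (hM : ∀ p ∈ Icc (0 : Fin (n + 1) → ℝ) 1, ‖fderiv ℝ f p‖ ≤ M)
    {i j k : Fin (n + 1)} (hki : k ≠ i) {a b c d s : ℝ} (ha : 0 ≤ a) (hab : a ≤ b)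
    (hs : 0 ≤ s) (hbs : b + s ≤ 1) (hc : 0 ≤ c) (hcd : c ≤ d) (hd : d ≤ 1) :
    |(∫ p in slabBox i j (a + s) (b + s) c d, fderiv ℝ f p (Pi.single k 1))
      - ∫ p in slabBox i j a b c d, fderiv ℝ f p (Pi.single k 1)| ≤ 2 * M * (s * (b - a)) := by
  set e : Fin (n + 1) → ℝ := Pi.single i s with he
  have hM0 : 0 ≤ M := (norm_nonneg _).trans (hM 0 ⟨le_rfl, zero_le_one⟩)
  have hcont : Continuous fun p => fderiv ℝ f p (Pi.single k 1) :=
    (hf.continuous_fderiv one_ne_zero).clm_apply continuous_const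
  have hdiff : Differentiable ℝ f := hf.differentiable one_ne_zero
  set F : (Fin (n + 1) → ℝ) → ℝ := fun p => f (p + e) - f p with hFdef
  have hF : ContDiff ℝ 1 F := (hf.comp (contDiff_id.add contDiff_const)).sub hf
  have hFd : ∀ p, fderiv ℝ F p = fderiv ℝ f (p + e) - fderiv ℝ f p := by
    intro p
    rw [hFdef, fderiv_fun_sub (by fun_prop) (hdiff p), fderiv_comp_add_right]
  have hpre : (fun p => p + e) ⁻¹' slabBox i j (a + s) (b + s) c d = slabBox i j a b c d := by
    ext p
    simp only [slabBox, mem_preimage, mem_univ_pi]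
    refine forall_congr' fun l => ?_
    unfold corner
    rcases eq_or_ne l i with rfl | hl
    · simp [he]
    · simp [he, hl]
  have htrans := (measurePreserving_add_right volume e).setIntegral_preimage_emb
    (measurableEmbedding_addRight e) (fun p => fderiv ℝ f p (Pi.single k 1))
    (slabBox i j (a + s) (b + s) c d)
  rw [hpre] at htrans
  have hInt : ∀ {φ : (Fin (n + 1) → ℝ) → ℝ}, Continuous φ →
      IntegrableOn φ (slabBox i j a b c d) := fun hφ =>
    (hφ.continuousOn.integrableOn_compact isCompact_Icc).mono_set (slabBox_subset_Icc i j a b c d)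
  rw [← htrans, ← integral_sub (hInt (by fun_prop)) (hInt hcont)]
  have hle := corner_le_corner i j hab hcd
  have hFle : ∀ p ∈ Icc (corner i j a c 0) (corner i j b d 1), |F p| ≤ M * s := by
    intro p hp
    have hp0 := Icc_corner_subset i j ha (by linarith) hc hd hp
    have hpi := hp.2 i
    simp only [corner, if_true] at hpi
    have hpe : p + e ∈ Icc (0 : Fin (n + 1) → ℝ) 1 := by
      have he0 : 0 ≤ e := Pi.single_nonneg.2 hs
      refine ⟨add_nonneg hp0.1 he0, fun l => ?_⟩
      rcases eq_or_ne l i with rfl | hl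
      · simp [he]; linarith
      · simpa [he, hl] using hp0.2 l
    have := (convex_Icc (0 : Fin (n + 1) → ℝ) 1).norm_image_sub_le_of_norm_fderiv_le
      (fun x _ => hdiff x) hM hp0 hpe
    simpa [he, Pi.norm_single, abs_of_nonneg hs] using this
  have key := abs_integral_partialDeriv_le hF hle hFle k
  rw [← setIntegral_congr_set (slabBox_ae_eq_Icc i j a b c d)] at key
  simp only [hFd, _root_.sub_apply] at key
  refine key.trans ?_
  have hprod : ∏ l, (corner i j b d 1 (k.succAbove l) - corner i j a c 0 (k.succAbove l))
      ≤ b - a := by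
    obtain ⟨l₀, hl₀⟩ := Fin.exists_succAbove_eq hki.symm
    rw [← Finset.mul_prod_erase _ _ (Finset.mem_univ l₀), hl₀]
    have : ∏ l ∈ Finset.univ.erase l₀,
        (corner i j b d 1 (k.succAbove l) - corner i j a c 0 (k.succAbove l)) ≤ 1 := by
      refine Finset.prod_le_one (fun l _ => sub_nonneg.2 (hle _)) fun l _ => ?_
      unfold corner
      split_ifs <;> linarith
    have h0 : corner i j b d 1 i - corner i j a c 0 i = b - a := by simp [corner]
    rw [h0]
    exact mul_le_of_le_one_right (sub_nonneg.2 hab) this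
  calc _ ≤ 2 * (M * s) * (b - a) := by gcongr
    _ = _ := by ring

theorem isLipschitzFlux_integral_partialDeriv {n : ℕ} {f : (Fin (n + 1) → ℝ) → ℝ}
    (hf : ContDiff ℝ 1 f) {M : ℝ} (hM : ∀ p ∈ Icc (0 : Fin (n + 1) → ℝ) 1, ‖fderiv ℝ f p‖ ≤ M)
    {i j k : Fin (n + 1)} (hij : i ≠ j) (hki : k ≠ i) :
    IsLipschitzFlux (2 * M)
      (fun a b c d => ∫ p in slabBox i j a b c d, fderiv ℝ f p (Pi.single k 1)) := by
  have hM0 : 0 ≤ M := (norm_nonneg _).trans (hM 0 ⟨le_rfl, zero_le_one⟩)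
  have hcont : Continuous fun p => fderiv ℝ f p (Pi.single k 1) :=
    (hf.continuous_fderiv one_ne_zero).clm_apply continuous_const
  refine ⟨?_, ?_, ?_, ?_⟩
  · intro a b c d ha hab hb hc hcd hd
    have hvol : volume.real (slabBox i j a b c d) = (b - a) * (d - c) := by
      rw [measureReal_def, slabBox, Real.volume_pi_Ioc_toReal (corner_le_corner i j hab hcd),
        prod_corner hij]
    have := norm_setIntegral_le_of_norm_le_const (μ := volume) (C := M)
      (s := slabBox i j a b c d) (f := fun p => fderiv ℝ f p (Pi.single k 1))
      ((measure_mono (slabBox_subset_Icc i j a b c d)).trans_lt isCompact_Icc.measure_lt_top)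
      fun p hp => by
        have := (fderiv ℝ f p).le_of_opNorm_le (hM p
          (Icc_corner_subset i j ha hb hc hd (slabBox_subset_Icc i j a b c d hp))) (Pi.single k 1)
        simpa [Pi.norm_single] using this
    rw [hvol] at this
    refine this.trans ?_
    have := mul_nonneg (sub_nonneg.2 hab) (sub_nonneg.2 hcd)
    nlinarith [mul_nonneg hM0 this]
  · intro a b b' c d _ hab hbb _ _ _ _
    exact setIntegral_slabBox_add hcont hab hbb
  · intro a b c d d' _ _ _ _ hcd hdd _
    simp only [slabBox_swap hij]
    exact setIntegral_slabBox_add hcont hcd hdd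
  · intro a b c d s ha hab hs hbs hc hcd hd
    exact abs_integral_partialDeriv_shift_le hf hM hki ha hab hs hbs hc hcd hd

theorem setIntegral_slabBox_eq_intervalIntegral {n : ℕ} {G : ℝ → ℝ → ℝ}
    (hG : Continuous fun q : ℝ × ℝ => G q.1 q.2) {a b c d : ℝ} (hab : a ≤ b) (hcd : c ≤ d) :
    ∫ p in slabBox (0 : Fin (n + 2)) 1 a b c d, G (p 0) (p 1)
      = ∫ u in a..b, ∫ w in c..d, G u w := by
  have hpi := Measure.restrict_pi_pi (fun _ : Fin (n + 2) => (volume : Measure ℝ))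
    fun k => Ioc (corner 0 1 a c 0 k) (corner 0 1 b d 1 k)
  have hInt : IntegrableOn (fun p : Fin (n + 2) → ℝ => G (p 0) (p 1)) (slabBox 0 1 a b c d) := by
    have hc : Continuous fun p : Fin (n + 2) → ℝ => G (p 0) (p 1) :=
      hG.comp (f := fun p : Fin (n + 2) → ℝ => (p 0, p 1)) (by fun_prop)
    exact (hc.continuousOn.integrableOn_compact isCompact_Icc).mono_set
      (slabBox_subset_Icc 0 1 a b c d)
  rw [IntegrableOn, slabBox, volume_pi, hpi] at hInt
  rw [slabBox, volume_pi, hpi]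
  set μ : Fin (n + 2) → Measure ℝ :=
    fun k => volume.restrict (Ioc (corner 0 1 a c 0 k) (corner 0 1 b d 1 k)) with hμ
  have hμ0 : μ 0 = volume.restrict (Ioc a b) := by simp [hμ, corner]
  have hμ1 : μ 1 = volume.restrict (Ioc c d) := by simp [hμ, corner]
  have hμ2 : ∀ k : Fin n, μ k.succ.succ = volume.restrict (Ioc 0 1) := by
    intro k
    have h1 : k.succ.succ ≠ 0 := Fin.succ_ne_zero _
    have h2 : k.succ.succ ≠ 1 := by
      rw [← Fin.succ_zero_eq_one]
      exact fun h => Fin.succ_ne_zero _ (Fin.succ_injective _ h)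
    simp [hμ, corner, h1, h2]
  have hfin : ∀ k, IsFiniteMeasure (μ k) := fun k => by
    simp only [hμ]; infer_instance
  have htail : ∀ u, ∫ q, G u (q 0) ∂Measure.pi (fun k : Fin (n + 1) => μ k.succ)
      = ∫ w in c..d, G u w := by
    intro u
    have h := (measurePreserving_piFinSuccAbove (fun k : Fin (n + 1) => μ k.succ) 0).integral_comp'
      (fun z : ℝ × (Fin n → ℝ) => G u z.1)
    simp only [MeasurableEquiv.piFinSuccAbove_apply] at h
    rw [intervalIntegral.integral_of_le hcd, ← hμ1]
    refine h.trans ?_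
    rw [integral_fun_fst (fun w => G u w)]
    simp [measureReal_def, Measure.pi_univ, hμ2]
  have h := (measurePreserving_piFinSuccAbove μ 0).integral_comp'
    (fun z : ℝ × (Fin (n + 1) → ℝ) => G z.1 (z.2 0))
  refine Eq.trans ?_ (h.trans ?_)
  · rfl
  rw [integral_prod]
  · simp only [Fin.succAbove_zero, htail]
    rw [intervalIntegral.integral_of_le hab, hμ0]
  · refine ((measurePreserving_piFinSuccAbove μ 0).integrable_comp_emb
      (MeasurableEquiv.piFinSuccAbove _ 0).measurableEmbedding).1 ?_
    exact hInt

/-- A vector field with derivative bounded by `K` on the unit cube, whose divergence there depends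
only on the first two coordinates, induces two Lipschitz fluxes adding up to the integral of its
divergence. -/
theorem exists_isLipschitzFlux_of_diver_eq {n : ℕ}
    {v : EuclideanSpace ℝ (Fin (n + 2)) → EuclideanSpace ℝ (Fin (n + 2))} (hv : ContDiff ℝ 1 v)
    {K : ℝ} (hK : ∀ x ∈ unitCube (n + 2), ‖fderiv ℝ v x‖ ≤ K) {G : ℝ → ℝ → ℝ}
    (hG : Continuous fun q : ℝ × ℝ => G q.1 q.2)
    (hdiv : ∀ x ∈ unitCube (n + 2), diver v x = G (x 0) (x 1)) :
    letI K' : ℝ := Fintype.card (Fin (n + 2)) *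
      (2 * (K * ‖((EuclideanSpace.equiv (Fin (n + 2)) ℝ).symm :
        (Fin (n + 2) → ℝ) →L[ℝ] EuclideanSpace ℝ (Fin (n + 2)))‖))
    ∃ A B, IsLipschitzFlux K' A ∧ IsLipschitzFlux K' B ∧
      ∀ a b c d, 0 ≤ a → a ≤ b → b ≤ 1 → 0 ≤ c → c ≤ d → d ≤ 1 →
        A c d a b + B a b c d = ∫ u in a..b, ∫ w in c..d, G u w := by
  set T : (Fin (n + 2) → ℝ) →L[ℝ] EuclideanSpace ℝ (Fin (n + 2)) :=
    ((EuclideanSpace.equiv (Fin (n + 2)) ℝ).symm :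
      (Fin (n + 2) → ℝ) →L[ℝ] EuclideanSpace ℝ (Fin (n + 2)))
  have hTapp : ∀ p k, T p k = p k := fun p k => rfl
  have hcube : ∀ p ∈ Icc (0 : Fin (n + 2) → ℝ) 1, T p ∈ unitCube (n + 2) :=
    fun p hp k => ⟨hp.1 k, hp.2 k⟩
  set M := K * ‖T‖ with hMdef
  have hK0 : 0 ≤ K := (norm_nonneg _).trans (hK _ (hcube 0 ⟨le_rfl, zero_le_one⟩))
  have hM0 : 0 ≤ M := mul_nonneg hK0 (norm_nonneg _)
  set f : Fin (n + 2) → (Fin (n + 2) → ℝ) → ℝ := fun k p => v (T p) k with hf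
  have hfd : ∀ k p, HasFDerivAt (f k)
      ((EuclideanSpace.proj k : EuclideanSpace ℝ (Fin (n + 2)) →L[ℝ] ℝ) ∘L
        (fderiv ℝ v (T p) ∘L T)) p := fun k p =>
    (EuclideanSpace.proj k : EuclideanSpace ℝ (Fin (n + 2)) →L[ℝ] ℝ).hasFDerivAt.comp p
      (((hv.differentiable one_ne_zero) (T p)).hasFDerivAt.comp p T.hasFDerivAt)
  have hfC : ∀ k, ContDiff ℝ 1 (f k) := fun k =>
    (EuclideanSpace.proj k : EuclideanSpace ℝ (Fin (n + 2)) →L[ℝ] ℝ).contDiff.comp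
      (hv.comp T.contDiff)
  have hfM : ∀ k, ∀ p ∈ Icc (0 : Fin (n + 2) → ℝ) 1, ‖fderiv ℝ (f k) p‖ ≤ M := by
    intro k p hp
    rw [(hfd k p).fderiv]
    refine ContinuousLinearMap.opNorm_le_bound _ hM0 fun x => ?_
    refine (PiLp.norm_apply_le (fderiv ℝ v (T p) (T x)) k).trans ?_
    rw [hMdef, mul_assoc]
    exact ((fderiv ℝ v (T p)).le_of_opNorm_le (hK _ (hcube p hp)) _).trans
      (mul_le_mul_of_nonneg_left (T.le_opNorm x) hK0)
  have hfdiv : ∀ p ∈ Icc (0 : Fin (n + 2) → ℝ) 1,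
      ∑ k, fderiv ℝ (f k) p (Pi.single k 1) = G (p 0) (p 1) := by
    intro p hp
    have := hdiv _ (hcube p hp)
    rw [hTapp, hTapp] at this
    rw [← this, diver, LinearMap.trace_eq_sum_inner _ (EuclideanSpace.basisFun (Fin (n + 2)) ℝ)]
    refine Finset.sum_congr rfl fun k _ => ?_
    rw [(hfd k p).fderiv, EuclideanSpace.basisFun_apply, EuclideanSpace.inner_single_left]
    simp
    rfl
  have h01 : (0 : Fin (n + 2)) ≠ 1 := by simp
  set w : Fin (n + 2) → Fin (n + 2) → ℝ := fun i k => if k = i then 0 else if k = 0 then 1 else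
    if k = 1 then 1 else 1 / 2 with hw
  have hw1 : ∀ i k, |w i k| ≤ 1 := fun i k => by
    simp only [hw]
    split_ifs <;> norm_num [abs_le]
  have hwadd : ∀ k, w 1 k + w 0 k = 1 := fun k => by
    simp only [hw]
    split_ifs <;> simp_all
    norm_num
  have hflux : ∀ i j, i ≠ j → IsLipschitzFlux (Fintype.card (Fin (n + 2)) * (2 * M))
      (fun a b c d => ∑ k, w i k *
        ∫ p in slabBox i j a b c d, fderiv ℝ (f k) p (Pi.single k 1)) := fun i j hij =>
    IsLipschitzFlux.sum (by positivity) (hw1 i) fun k hk =>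
      isLipschitzFlux_integral_partialDeriv (hfC k) (hfM k) hij fun hki => hk (by simp [hw, hki])
  refine ⟨_, _, hflux 1 0 h01.symm, hflux 0 1 h01, ?_⟩
  intro a b c d ha hab hb hc hcd hd
  simp only [slabBox_swap h01.symm c d a b]
  rw [← Finset.sum_add_distrib]
  simp only [← add_mul, hwadd, one_mul]
  rw [← setIntegral_slabBox_eq_intervalIntegral (n := n) hG hab hcd, ← integral_finsetSum]
  · exact setIntegral_congr_fun (measurableSet_slabBox ..) fun p hp =>
      hfdiv p (Icc_corner_subset 0 1 ha hb hc hd (slabBox_subset_Icc 0 1 a b c d hp))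
  · intro k _
    have hcont : Continuous fun p => fderiv ℝ (f k) p (Pi.single k 1) :=
      ((hfC k).continuous_fderiv one_ne_zero).clm_apply continuous_const
    exact (hcont.continuousOn.integrableOn_compact isCompact_Icc).mono_set
      (slabBox_subset_Icc 0 1 a b c d)

/-- A bound of the `C¹` norm of solutions of the divergence equation by the `C⁰` norm of the
right-hand side fails. -/
theorem exists_contDiff_forall_diver_eq_lt_norm_fderiv (n : ℕ) (K : ℝ) :
    ∃ g : EuclideanSpace ℝ (Fin (n + 2)) → ℝ, ContDiff ℝ (⊤ : ℕ∞) g ∧ (∀ x, |g x| ≤ 1) ∧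
      ∀ v : EuclideanSpace ℝ (Fin (n + 2)) → EuclideanSpace ℝ (Fin (n + 2)), ContDiff ℝ 1 v →
        (∀ x ∈ unitCube (n + 2), diver v x = g x) →
        ∃ x ∈ unitCube (n + 2), K < ‖fderiv ℝ v x‖ := by
  set K' : ℝ := Fintype.card (Fin (n + 2)) *
    (2 * (K * ‖((EuclideanSpace.equiv (Fin (n + 2)) ℝ).symm :
      (Fin (n + 2) → ℝ) →L[ℝ] EuclideanSpace ℝ (Fin (n + 2)))‖)) with hK'
  rcases lt_or_ge K 0 with hK | hK
  · exact ⟨0, contDiff_const, by simp, fun v _ _ =>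
      ⟨0, fun k => by simp, hK.trans_le (norm_nonneg _)⟩⟩
  have hK'0 : 0 ≤ K' := by positivity
  obtain ⟨m, hm⟩ := exists_nat_gt (80 * K')
  obtain ⟨g, hg, -, hgB⟩ := exists_pattern_flux_le hK'0 m
  refine ⟨fun x => g (x 0) (x 1), ?_, fun x => hg.abs_le_one _ _, fun v hv hdiv => ?_⟩
  · exact hg.contDiff.comp
      (f := fun x : EuclideanSpace ℝ (Fin (n + 2)) => (x 0, x 1)) (by fun_prop)
  by_contra! hle
  obtain ⟨A, B, hA, hB, hAB⟩ :=
    exists_isLipschitzFlux_of_diver_eq hv hle hg.contDiff.continuous hdiv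
  have h1 := hgB A B hA hB 0 0 1 le_rfl le_rfl one_pos (by simp) (by simp)
    fun a b c d h1 h2 h3 h4 h5 h6 => by
      simpa using hAB a b c d h1 h2 (by simpa using h3) h4 h5 (by simpa using h6)
  have h2 := (abs_le.1 (hB.abs_le (a := 0) (b := 1) (c := 0) (d := 1) le_rfl zero_le_one le_rfl
    le_rfl zero_le_one le_rfl)).1
  rw [← hK'] at h2
  norm_num at h1 h2
  linarith

theorem isCompact_unitCube (d : ℕ) : IsCompact (unitCube d) := by
  have : unitCube d = EuclideanSpace.equiv (Fin d) ℝ ⁻¹' Icc 0 1 := by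
    ext x
    exact ⟨fun h => ⟨fun k => (h k).1, fun k => (h k).2⟩, fun h k => ⟨h.1 k, h.2 k⟩⟩
  rw [this]
  exact (EuclideanSpace.equiv (Fin d) ℝ).toHomeomorph.isCompact_preimage.2 isCompact_Icc

theorem c0Norm_le {d : ℕ} {g : EuclideanSpace ℝ (Fin d) → ℝ} {r : ℝ} (hg : ∀ x, |g x| ≤ r) :
    c0Norm g ≤ r :=
  csSup_le ⟨_, 0, fun k => by simp, rfl⟩ (by rintro _ ⟨x, -, rfl⟩; exact hg x)

theorem norm_fderiv_le_c1Norm {d : ℕ} {v : EuclideanSpace ℝ (Fin d) → EuclideanSpace ℝ (Fin d)}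
    (hv : ContDiff ℝ 1 v) {x : EuclideanSpace ℝ (Fin d)} (hx : x ∈ unitCube d) :
    ‖fderiv ℝ v x‖ ≤ c1Norm v := by
  have hc : Continuous fun x => ‖v x‖ + ‖fderiv ℝ v x‖ :=
    hv.continuous.norm.add (hv.continuous_fderiv one_ne_zero).norm
  refine le_trans ?_ (le_csSup ((isCompact_unitCube d).image hc).bddAbove ⟨x, hx, rfl⟩)
  simp

/-- Non-estimate theorem for the divergence equation: there is no right inverse of the
divergence operator, defined on smooth functions of C⁰-norm at most r, which is
Lipschitz from the C⁰ norm to the C¹ norm. -/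
theorem no_lipschitz_right_inverse_divergence (d : ℕ) (hd : 2 ≤ d)
    (r : ℝ) (hr : 0 < r) (K : ℝ) (hK : 0 < K) :
    ¬ ∃ 𝓛 : (EuclideanSpace ℝ (Fin d) → ℝ) →
        (EuclideanSpace ℝ (Fin d) → EuclideanSpace ℝ (Fin d)),
      (∀ g, ContDiff ℝ (⊤ : ℕ∞) g → c0Norm g ≤ r →
        ContDiff ℝ (⊤ : ℕ∞) (𝓛 g) ∧ ∀ x ∈ unitCube d, diver (𝓛 g) x = g x) ∧
      (∀ g₁ g₂, ContDiff ℝ (⊤ : ℕ∞) g₁ → c0Norm g₁ ≤ r → ContDiff ℝ (⊤ : ℕ∞) g₂ → c0Norm g₂ ≤ r →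
        c1Norm (fun x => 𝓛 g₁ x - 𝓛 g₂ x) ≤ K * c0Norm (fun x => g₁ x - g₂ x)) := by
  rintro ⟨𝓛, hdiv, hlip⟩
  obtain ⟨n, rfl⟩ := Nat.exists_eq_add_of_le' hd
  obtain ⟨g, hg, hg1, hbad⟩ := exists_contDiff_forall_diver_eq_lt_norm_fderiv n K
  have hrg : ContDiff ℝ (⊤ : ℕ∞) fun x => r * g x := contDiff_const.mul hg
  have hrg1 : ∀ x, |r * g x| ≤ r := fun x => by
    rw [abs_mul, abs_of_pos hr]
    exact mul_le_of_le_one_right hr.le (hg1 x)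
  have hz1 : c0Norm (fun _ : EuclideanSpace ℝ (Fin (n + 2)) => (0 : ℝ)) ≤ r :=
    c0Norm_le fun _ => by simpa using hr.le
  obtain ⟨hC₁, hd₁⟩ := hdiv _ hrg (c0Norm_le hrg1)
  obtain ⟨hC₀, hd₀⟩ := hdiv _ contDiff_const hz1
  have hlip' := hlip _ _ hrg (c0Norm_le hrg1) contDiff_const hz1
  set u := fun x => 𝓛 (fun x => r * g x) x - 𝓛 (fun _ => 0) x with hu
  have huC : ContDiff ℝ 1 u := (hC₁.sub hC₀).of_le (by exact_mod_cast le_top)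
  have hud : ∀ x, fderiv ℝ u x
      = fderiv ℝ (𝓛 fun x => r * g x) x - fderiv ℝ (𝓛 fun _ => 0) x := fun x =>
    fderiv_fun_sub (hC₁.differentiable (by simp) x) (hC₀.differentiable (by simp) x)
  have hvd : ∀ x, fderiv ℝ (fun x => r⁻¹ • u x) x = r⁻¹ • fderiv ℝ u x := fun x =>
    fderiv_fun_const_smul (huC.differentiable one_ne_zero x) _
  obtain ⟨x, hx, hlt⟩ := hbad (fun x => r⁻¹ • u x) (huC.const_smul r⁻¹) fun x hx => by
    have h₁ := hd₁ x hx
    have h₀ := hd₀ x hx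
    simp only [diver] at h₁ h₀ ⊢
    rw [hvd, hud]
    simp only [ContinuousLinearMap.toLinearMap_smul, ContinuousLinearMap.toLinearMap_sub, map_smul,
      map_sub, h₁, h₀]
    simp [hr.ne']
  have hle : ‖fderiv ℝ u x‖ ≤ K * r :=
    (norm_fderiv_le_c1Norm huC hx).trans (hlip'.trans
      (mul_le_mul_of_nonneg_left (c0Norm_le (by simpa using hrg1)) hK.le))
  rw [hvd, norm_smul, Real.norm_eq_abs, abs_of_pos (inv_pos.2 hr), lt_inv_mul_iff₀ hr] at hlt
  linarith
end
end
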